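/- arXiv:2006.04167 — 2 statements merged into one kernel-verified Lean document; each statement's English description precedes it below -/
import Mathlib

section
/- A dd-sirup (cov_A^⊥, q) is FO-rewritable if and only if q is a 0-CQ or q contains an FT-twin. -/
attribute [local instance] Classical.propDecidable

namespace DS

/-- Ground/query atoms over binary-predicate alphabet `σ` and node type `α`:
unary predicates `F`, `T`, `A` and binary predicates `R r`. -/
inductive At (σ α : Type) : Type
  | F : α → At σ α
  | T : α → At σ α
  | A : α → At σ α
  | R : σ → α → α → At σ α

namespace At

/-- Renaming of the nodes of an atom. -/
def map {σ α β : Type} (h : α → β) : At σ α → At σ β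
  | .F a => .F (h a)
  | .T a => .T (h a)
  | .A a => .A (h a)
  | .R r a b => .R r (h a) (h b)

/-- The nodes occurring in an atom. -/
def vars {σ α : Type} : At σ α → Set α
  | .F a => {a}
  | .T a => {a}
  | .A a => {a}
  | .R _ a b => {a, b}

end At

/-- An interpretation over domain `δ`. -/
structure Interp (σ δ : Type) where
  FS : δ → Prop
  TS : δ → Prop
  AS : δ → Prop
  RS : σ → δ → δ → Prop

/-- Truth of an atom in an interpretation. -/
def Interp.satAt {σ δ : Type} (I : Interp σ δ) : At σ δ → Prop
  | .F a => I.FS a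
  | .T a => I.TS a
  | .A a => I.AS a
  | .R r a b => I.RS r a b

/-- `I ⊨ q`: there is a homomorphism from the Boolean CQ `q` into `I`. -/
def Interp.satCQ {σ δ V : Type} (I : Interp σ δ) (q : Set (At σ V)) : Prop :=
  ∃ h : V → δ, ∀ a ∈ q, I.satAt (At.map h a)

/-- An ABox viewed as an interpretation over its own individuals. -/
def toInterp {σ α : Type} (A : Set (At σ α)) : Interp σ α where
  FS a := At.F a ∈ A
  TS a := At.T a ∈ A
  AS a := At.A a ∈ A
  RS r a b := At.R r a b ∈ A

/-- An individual is undecided if it is labelled `A` but neither `F` nor `T`. -/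
def undecided {σ α : Type} (A : Set (At σ α)) (a : α) : Prop :=
  At.A a ∈ A ∧ At.F a ∉ A ∧ At.T a ∉ A

/-- The minimal model of `cov_A` and the ABox `A` determined by a choice `c` of
one of `F`/`T` for each undecided `A`-individual. -/
def minModel {σ α : Type} (A : Set (At σ α)) (c : α → Bool) : Interp σ α where
  FS a := At.F a ∈ A ∨ (undecided A a ∧ c a = true)
  TS a := At.T a ∈ A ∨ (undecided A a ∧ c a = false)
  AS a := At.A a ∈ A
  RS r a b := At.R r a b ∈ A

/-- `F` and `T` are interpreted disjointly. -/
def disjointFT {σ δ : Type} (I : Interp σ δ) : Prop := ∀ d : δ, ¬ (I.FS d ∧ I.TS d)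

/-- Certain answer to the OMQ `(cov_A, q)` over the ABox `A`:
`q` holds in every minimal model of `cov_A` and `A`. -/
def covACert {σ α V : Type} (A : Set (At σ α)) (q : Set (At σ V)) : Prop :=
  ∀ c : α → Bool, (minModel A c).satCQ q

/-- Certain answer to the OMQ `(cov_A^⊥, q)` over the ABox `A`:
`q` holds in every minimal model of `cov_A^⊥` and `A` (the minimal models of
`cov_A` in which `F` and `T` are disjoint). -/
def covABotCert {σ α V : Type} (A : Set (At σ α)) (q : Set (At σ V)) : Prop :=
  ∀ c : α → Bool, disjointFT (minModel A c) → (minModel A c).satCQ q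

/-- No `FT`-twin occurs. -/
def twinFree {σ α : Type} (A : Set (At σ α)) : Prop :=
  ∀ a : α, ¬ (At.F a ∈ A ∧ At.T a ∈ A)

/-- A CQ does not use the unary predicate `A`. -/
def noA {σ V : Type} (q : Set (At σ V)) : Prop := ∀ v : V, At.A v ∉ q

/-- `x` occurs in `q`. -/
def occ {σ V : Type} (q : Set (At σ V)) (x : V) : Prop := ∃ a ∈ q, x ∈ At.vars a

/-- Connectedness of a CQ. -/
def connCQ {σ V : Type} (q : Set (At σ V)) : Prop :=
  ∀ x y : V, occ q x → occ q y →
    Relation.ReflTransGen (fun u v => ∃ a ∈ q, u ∈ At.vars a ∧ v ∈ At.vars a) x y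

/-- Solitary `F`-node of a CQ. -/
def solF {σ V : Type} (q : Set (At σ V)) (x : V) : Prop := At.F x ∈ q ∧ At.T x ∉ q

/-- Solitary `T`-node of a CQ. -/
def solT {σ V : Type} (q : Set (At σ V)) (y : V) : Prop := At.T y ∈ q ∧ At.F y ∉ q
open FirstOrder

/-- The unary predicate symbols of the signature. -/
inductive URel : Type | uf | ut | ua

/-- Relation symbols of the first-order signature: `F`, `T`, `A` unary and the
symbols of `σ` binary. -/
def Rels (σ : Type) : ℕ → Type
  | 1 => URel
  | 2 => σ
  | _ => Empty

/-- The first-order language of the signature. -/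
def Lsig (σ : Type) : Language := ⟨fun _ => Empty, Rels σ⟩

/-- Semantics of the relation symbols in an interpretation. -/
def relSem {σ δ : Type} (I : Interp σ δ) : ∀ n, Rels σ n → (Fin n → δ) → Prop
  | 0, r, _ => Empty.elim r
  | 1, r, v => match r with
    | .uf => I.FS (v 0)
    | .ut => I.TS (v 0)
    | .ua => I.AS (v 0)
  | 2, r, v => I.RS r (v 0) (v 1)
  | (_ + 3), r, _ => Empty.elim r

/-- An interpretation as a first-order structure. -/
def interpStructure {σ δ : Type} (I : Interp σ δ) : (Lsig σ).Structure δ where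
  funMap := fun f _ => Empty.elim f
  RelMap := fun {n} r v => relSem I n r v

/-- The individuals occurring in an ABox. -/
def indSet {σ α : Type} (A : Set (At σ α)) : Set α := {a | ∃ b ∈ A, a ∈ At.vars b}

/-- The ABox `A` as an interpretation whose domain is `ind(A)`. -/
def restrictI {σ α : Type} (A : Set (At σ α)) : Interp σ (indSet A) where
  FS a := At.F (a : α) ∈ A
  TS a := At.T (a : α) ∈ A
  AS a := At.A (a : α) ∈ A
  RS r a b := At.R r (a : α) (b : α) ∈ A

/-- Truth of a first-order sentence in the ABox `A` regarded as a finite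
relational structure with domain `ind(A)`. -/
def foHolds {σ α : Type} (A : Set (At σ α)) (Φ : (Lsig σ).Sentence) : Prop :=
  @FirstOrder.Language.Sentence.Realize (Lsig σ) (indSet A) (interpStructure (restrictI A)) Φ

/-- A `0`-CQ: a CQ with no solitary `F`-node or no solitary `T`-node. -/
def isZeroCQ {σ V : Type} (q : Set (At σ V)) : Prop :=
  (∀ x, ¬ solF q x) ∨ (∀ x, ¬ solT q x)

/-- FO-rewritability of the dd-sirup `(cov_A^⊥, q)`: there is a first-order
sentence whose truth over any ABox (regarded as a finite relational structure
with domain `ind(A)`) coincides with the certain answer. -/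
def FORewritableBot {σ V : Type} (q : Set (At σ V)) : Prop :=
  ∃ Φ : (Lsig σ).Sentence, ∀ (α : Type) (A : Set (At σ α)), A.Finite →
    (covABotCert A q ↔ foHolds A Φ)

/-! ### Generic facts -/

theorem mem_vars_map {σ α β : Type} (h : α → β) (a : At σ α) (u : β) :
    u ∈ At.vars (At.map h a) ↔ ∃ w ∈ At.vars a, h w = u := by
  cases a <;> simp [At.vars, At.map, eq_comm]

theorem vars_nonempty {σ α : Type} (a : At σ α) : ∃ v, v ∈ At.vars a := by
  cases a <;> simp [At.vars]

theorem disjoint_of_twinFree {σ α : Type} {A : Set (At σ α)} (hA : twinFree A) (c : α → Bool) :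
    disjointFT (minModel A c) := by
  rintro d ⟨h1 | ⟨h1, h1c⟩, h2 | ⟨h2, h2c⟩⟩
  · exact hA d ⟨h1, h2⟩
  · exact h2.2.1 h1
  · exact h1.2.2 h2
  · simp [h1c] at h2c

theorem cert_of_twin {σ α V : Type} {A : Set (At σ α)} (q : Set (At σ V)) (hA : ¬ twinFree A) :
    covABotCert A q := by
  intro c hc
  exfalso
  apply hA
  rintro a ⟨h1, h2⟩
  exact hc a ⟨Or.inl h1, Or.inl h2⟩

/-- Homomorphism transfer on a subset of nodes. -/
theorem satCQ_of_hom {σ δ ε V : Type} {I : Interp σ δ} {J : Interp σ ε} {q : Set (At σ V)}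
    (hqA : noA q) (g : δ → ε) (h : V → δ) (hh : ∀ a ∈ q, I.satAt (At.map h a))
    (P : δ → Prop) (hP : ∀ v, occ q v → P (h v))
    (hF : ∀ d, P d → I.FS d → J.FS (g d)) (hT : ∀ d, P d → I.TS d → J.TS (g d))
    (hR : ∀ r d e, P d → P e → I.RS r d e → J.RS r (g d) (g e)) : J.satCQ q := by
  refine ⟨fun v => g (h v), fun a ha => ?_⟩
  have h1 := hh a ha
  have h2 : ∀ v ∈ At.vars a, P (h v) := fun v hv => hP v ⟨a, ha, hv⟩
  cases a with
  | F v => exact hF _ (h2 v (by simp [At.vars])) h1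
  | T v => exact hT _ (h2 v (by simp [At.vars])) h1
  | A v => exact absurd ha (hqA v)
  | R r v w => exact hR r _ _ (h2 v (by simp [At.vars])) (h2 w (by simp [At.vars])) h1

/-! ### The sentence of a CQ -/

open FirstOrder.Language in
def atFormula {σ α : Type} : At σ α → (Lsig σ).Formula (Empty ⊕ α)
  | .F a => Relations.formula₁ (L := Lsig σ) (show (Lsig σ).Relations 1 from URel.uf) (Term.var (Sum.inr a))
  | .T a => Relations.formula₁ (L := Lsig σ) (show (Lsig σ).Relations 1 from URel.ut) (Term.var (Sum.inr a))
  | .A a => Relations.formula₁ (L := Lsig σ) (show (Lsig σ).Relations 1 from URel.ua) (Term.var (Sum.inr a))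
  | .R r a b => Relations.formula₂ (L := Lsig σ) (show (Lsig σ).Relations 2 from r)
      (Term.var (Sum.inr a)) (Term.var (Sum.inr b))

theorem realize_atFormula {σ α δ : Type} (I : Interp σ δ) (a : At σ α) (g : α → δ)
    (v : Empty → δ) :
    @FirstOrder.Language.Formula.Realize (Lsig σ) δ (interpStructure I) _ (atFormula a)
      (Sum.elim v g) ↔ I.satAt (At.map g a) := by
  let _ := interpStructure I
  cases a with
  | F a => exact FirstOrder.Language.Formula.realize_rel₁ (L := Lsig σ) (M := δ)
  | T a => exact FirstOrder.Language.Formula.realize_rel₁ (L := Lsig σ) (M := δ)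
  | A a => exact FirstOrder.Language.Formula.realize_rel₁ (L := Lsig σ) (M := δ)
  | R r a b => exact FirstOrder.Language.Formula.realize_rel₂ (L := Lsig σ) (M := δ)

theorem exists_sentence {σ V : Type} (q : Set (At σ V)) (hq : q.Finite) (hne : q.Nonempty) :
    ∃ Φ : (Lsig σ).Sentence, ∀ (α : Type) (A : Set (At σ α)),
      foHolds A Φ ↔ (toInterp A).satCQ q := by
  have hO : Finite {v // occ q v} := by
    have : {v | occ q v} = ⋃ a ∈ q, At.vars a := by
      ext v; simp [occ]
    refine Set.Finite.to_subtype (s := {v | occ q v}) ?_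
    rw [this]
    refine hq.biUnion fun a _ => ?_
    cases a <;> simp [At.vars]
  have hQ : Finite q := hq.to_subtype
  obtain ⟨a0, ha0⟩ := hne
  obtain ⟨v0, hv0⟩ := vars_nonempty a0
  let e : V → {v // occ q v} := fun v => if h : occ q v then ⟨v, h⟩ else ⟨v0, a0, ha0, hv0⟩
  refine ⟨(FirstOrder.Language.Formula.iInf (fun a : q => atFormula (At.map e a.1))).iExs
    {v // occ q v}, fun α A => ?_⟩
  let _ := interpStructure (restrictI A)
  unfold foHolds FirstOrder.Language.Sentence.Realize
  rw [FirstOrder.Language.Formula.realize_iExs]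
  simp only [FirstOrder.Language.Formula.realize_iInf]
  constructor
  · rintro ⟨g, hg⟩
    refine ⟨fun v => (g (e v)).1, fun a ha => ?_⟩
    have := (realize_atFormula _ _ _ _).1 (hg ⟨a, ha⟩)
    cases a <;> exact this
  · rintro ⟨h, hh⟩
    have hmem : ∀ v, occ q v → h v ∈ indSet A := by
      rintro v ⟨a, ha, hv⟩
      refine ⟨At.map h a, ?_, (mem_vars_map _ _ _).2 ⟨v, hv, rfl⟩⟩
      have := hh a ha
      cases a <;> exact this
    refine ⟨fun v => ⟨h v.1, hmem v.1 v.2⟩, fun a => ?_⟩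
    refine (realize_atFormula _ _ _ _).2 ?_
    obtain ⟨a, ha⟩ := a
    have h1 := hh a ha
    have h2 : ∀ v ∈ At.vars a, (e v).1 = v := fun v hv => by
      simp only [e, dif_pos (show occ q v from ⟨a, ha, hv⟩)]
    cases a with
    | F v =>
      have := h2 v (by simp [At.vars])
      simpa [At.map, Interp.satAt, restrictI, toInterp, this] using h1
    | T v =>
      have := h2 v (by simp [At.vars])
      simpa [At.map, Interp.satAt, restrictI, toInterp, this] using h1
    | A v =>
      have := h2 v (by simp [At.vars])
      simpa [At.map, Interp.satAt, restrictI, toInterp, this] using h1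
    | R r v w =>
      have hv := h2 v (by simp [At.vars])
      have hw := h2 w (by simp [At.vars])
      simpa [At.map, Interp.satAt, restrictI, toInterp, hv, hw] using h1

theorem twin_sentence (σ : Type) : ∃ Φ : (Lsig σ).Sentence, ∀ (α : Type) (A : Set (At σ α)),
      foHolds A Φ ↔ ¬ twinFree A := by
  obtain ⟨Φ, hΦ⟩ := exists_sentence (σ := σ) (V := Unit) {At.F (), At.T ()} (by simp) (by simp)
  refine ⟨Φ, fun α A => ?_⟩
  rw [hΦ]
  simp only [twinFree, not_forall, not_not]
  constructor
  · rintro ⟨h, hh⟩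
    exact ⟨h (), hh (At.F ()) (by simp), hh (At.T ()) (by simp)⟩
  · rintro ⟨a, h1, h2⟩
    refine ⟨fun _ => a, ?_⟩
    intro b hb
    rcases hb with rfl | rfl
    · exact h1
    · exact h2

/-- The easy direction. -/
theorem easy_direction {σ V : Type} (q : Set (At σ V)) (hqfin : q.Finite) (hqne : q.Nonempty)
    (hqA : noA q) (h : isZeroCQ q ∨ ∃ x, At.F x ∈ q ∧ At.T x ∈ q) : FORewritableBot q := by
  obtain ⟨Ψ, hΨ⟩ := twin_sentence σ
  by_cases ht : ∃ x, At.F x ∈ q ∧ At.T x ∈ q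
  · obtain ⟨x, hx1, hx2⟩ := ht
    refine ⟨Ψ, fun α A _ => ?_⟩
    rw [hΨ]
    refine ⟨fun hc hA => ?_, cert_of_twin q⟩
    obtain ⟨h, hh⟩ := hc (fun _ => true) (disjoint_of_twinFree hA _)
    exact disjoint_of_twinFree hA (fun _ => true) (h x) ⟨hh _ hx1, hh _ hx2⟩
  · have hz := h.resolve_right ht
    obtain ⟨Φ, hΦ⟩ := exists_sentence q hqfin hqne
    refine ⟨Ψ ⊔ Φ, fun α A _ => ?_⟩
    have hor : foHolds A (Ψ ⊔ Φ) ↔ foHolds A Ψ ∨ foHolds A Φ := by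
      let _ := interpStructure (restrictI A)
      exact FirstOrder.Language.Formula.realize_sup
    rw [hor, hΨ, hΦ]
    constructor
    · intro hc
      by_cases hA : twinFree A
      · right
        rcases hz with hz | hz
        · have hnF : ∀ x, At.F x ∉ q := fun x hx => hz x ⟨hx, fun hx' => ht ⟨x, hx, hx'⟩⟩
          obtain ⟨h, hh⟩ := hc (fun _ => true) (disjoint_of_twinFree hA _)
          refine ⟨h, fun a ha => ?_⟩
          have h1 := hh a ha
          cases a with
          | F v => exact absurd ha (hnF v)
          | T v => simpa [At.map, Interp.satAt, minModel, toInterp] using h1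
          | A v => exact h1
          | R r v w => exact h1
        · have hnT : ∀ x, At.T x ∉ q := fun x hx => hz x ⟨hx, fun hx' => ht ⟨x, hx', hx⟩⟩
          obtain ⟨h, hh⟩ := hc (fun _ => false) (disjoint_of_twinFree hA _)
          refine ⟨h, fun a ha => ?_⟩
          have h1 := hh a ha
          cases a with
          | F v => simpa [At.map, Interp.satAt, minModel, toInterp] using h1
          | T v => exact absurd ha (hnT v)
          | A v => exact h1
          | R r v w => exact h1
      · exact Or.inl hA
    · rintro (hA | ⟨h, hh⟩)
      · exact cert_of_twin q hA
      · intro c _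
        exact satCQ_of_hom hqA id h hh (fun _ => True) (fun _ _ => trivial)
          (fun d _ hd => Or.inl hd) (fun d _ hd => Or.inl hd) (fun r d e _ _ hd => hd)

/-! ### Back-and-forth -/

/-- Quantifier depth. -/
def qdepth {L : FirstOrder.Language} {α : Type} : ∀ {n : ℕ}, L.BoundedFormula α n → ℕ
  | _, .falsum => 0
  | _, .equal _ _ => 0
  | _, .rel _ _ => 0
  | _, .imp f g => max (qdepth f) (qdepth g)
  | _, .all f => qdepth f + 1

theorem term_var {σ : Type} {n : ℕ} (t : (Lsig σ).Term (Empty ⊕ Fin n)) :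
    ∃ i : Fin n, t = FirstOrder.Language.Term.var (Sum.inr i) := by
  cases t with
  | var x =>
    cases x with
    | inl e => exact e.elim
    | inr i => exact ⟨i, rfl⟩
  | func f _ => exact Empty.elim f

theorem back_forth {σ M N : Type} (I : Interp σ M) (J : Interp σ N)
    (Rl : ∀ n, ℕ → (Fin n → M) → (Fin n → N) → Prop)
    (hE : ∀ n k a b, Rl n k a b → ∀ i j, a i = a j ↔ b i = b j)
    (hF : ∀ n k a b, Rl n k a b → ∀ i, I.FS (a i) ↔ J.FS (b i))
    (hT : ∀ n k a b, Rl n k a b → ∀ i, I.TS (a i) ↔ J.TS (b i))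
    (hA : ∀ n k a b, Rl n k a b → ∀ i, I.AS (a i) ↔ J.AS (b i))
    (hR : ∀ n k a b, Rl n k a b → ∀ r i j, I.RS r (a i) (a j) ↔ J.RS r (b i) (b j))
    (forth : ∀ n k a b, Rl n (k + 1) a b → ∀ x, ∃ y,
      Rl (n + 1) k (Fin.snoc (α := fun _ => M) a x) (Fin.snoc (α := fun _ => N) b y))
    (back : ∀ n k a b, Rl n (k + 1) a b → ∀ y, ∃ x,
      Rl (n + 1) k (Fin.snoc (α := fun _ => M) a x) (Fin.snoc (α := fun _ => N) b y))
    {n : ℕ} (φ : (Lsig σ).BoundedFormula Empty n) :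
    ∀ (k : ℕ) (a : Fin n → M) (b : Fin n → N) (v : Empty → M) (w : Empty → N),
      qdepth φ ≤ k → Rl n k a b →
      (@FirstOrder.Language.BoundedFormula.Realize (Lsig σ) M (interpStructure I) _ _ φ v a ↔
       @FirstOrder.Language.BoundedFormula.Realize (Lsig σ) N (interpStructure J) _ _ φ w b) := by
  let _ := interpStructure I
  let _ := interpStructure J
  induction φ with
  | falsum => intros; exact Iff.rfl
  | equal t₁ t₂ =>
    intro k a b v w _ h
    obtain ⟨i, rfl⟩ := term_var t₁
    obtain ⟨j, rfl⟩ := term_var t₂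
    exact hE _ _ _ _ h i j
  | @rel n l R ts =>
    intro k a b v w _ h
    choose f hf using fun i => term_var (ts i)
    obtain rfl : ts = fun i => FirstOrder.Language.Term.var (Sum.inr (f i)) := funext hf
    match l, R, f with
    | 0, R, _ => exact Empty.elim R
    | 1, .uf, f => exact hF _ _ _ _ h (f 0)
    | 1, .ut, f => exact hT _ _ _ _ h (f 0)
    | 1, .ua, f => exact hA _ _ _ _ h (f 0)
    | 2, R, f => exact hR _ _ _ _ h R (f 0) (f 1)
    | (_ + 3), R, _ => exact Empty.elim R
  | imp f g ihf ihg =>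
    intro k a b v w hk h
    have h1 : qdepth f ≤ k := le_trans (le_max_left _ _) hk
    have h2 : qdepth g ≤ k := le_trans (le_max_right _ _) hk
    exact imp_congr (ihf k a b v w h1 h) (ihg k a b v w h2 h)
  | all f ih =>
    intro k a b v w hk h
    have hk' : qdepth f + 1 ≤ k := hk
    obtain ⟨k, rfl⟩ : ∃ k', k = k' + 1 := ⟨k - 1, by omega⟩
    constructor
    · intro H y
      obtain ⟨x, hx⟩ := back _ _ _ _ h y
      exact (ih k _ _ v w (by omega) hx).1 (H x)
    · intro H x
      obtain ⟨y, hy⟩ := forth _ _ _ _ h x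
      exact (ih k _ _ v w (by omega) hy).2 (H y)

/-! ### The game on cycles -/

/-- Shift along the cycles. -/
def sh {N : ℕ} {β : Type} (d : ℤ) (p : ZMod N × β) : ZMod N × β := (p.1 + (d : ZMod N), p.2)

theorem sh_zero {N : ℕ} {β : Type} (p : ZMod N × β) : sh 0 p = p := by
  simp [sh]

theorem sh_sh {N : ℕ} {β : Type} (d e : ℤ) (p : ZMod N × β) : sh d (sh e p) = sh (e + d) p := by
  simp [sh, add_assoc]

theorem sh_eq_iff {N : ℕ} {β : Type} (d e : ℤ) (p p' : ZMod N × β) :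
    sh d p = sh e p' ↔ sh (d - e) p = p' := by
  constructor
  · intro h
    have := congrArg (sh (-e)) h
    simpa [sh_sh, sh_zero, ← sub_eq_add_neg] using this
  · intro h
    rw [← h, sh_sh]
    congr 1
    ring

theorem sh_self_iff {N : ℕ} {β : Type} (d : ℤ) (p : ZMod N × β) :
    sh d p = p ↔ (N : ℤ) ∣ d := by
  rw [← ZMod.intCast_zmod_eq_zero_iff_dvd]
  simp [sh, Prod.ext_iff]

/-- Local equivalence of a list of matched points. -/
def RelP {N : ℕ} {β β' : Type} (k : ℕ) (P : List ((ZMod N × β) × (ZMod N × β'))) : Prop :=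
  ∀ p ∈ P, ∀ p' ∈ P, ∀ d : ℤ, |d| ≤ 2 ^ k → (sh d p.1 = p'.1 ↔ sh d p.2 = p'.2)

theorem RelP.swap {N : ℕ} {β β' : Type} {k : ℕ} {P : List ((ZMod N × β) × (ZMod N × β'))}
    (h : RelP k P) : RelP k (P.map Prod.swap) := by
  intro p hp p' hp' d hd
  simp only [List.mem_map] at hp hp'
  obtain ⟨u, hu, rfl⟩ := hp
  obtain ⟨u', hu', rfl⟩ := hp'
  exact (h u hu u' hu' d hd).symm

theorem RelP.extend {N : ℕ} {β β' : Type} [Nonempty β'] {K k : ℕ}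
    (hN : K * (2 ^ K + 1) < N)
    {P : List ((ZMod N × β) × (ZMod N × β'))} (hlen : P.length + (k + 1) ≤ K)
    (h : RelP (k + 1) P) (a : ZMod N × β) : ∃ b, RelP k ((a, b) :: P) := by
  have hpow : (2 : ℤ) ^ (k + 1) = 2 * 2 ^ k := by ring
  have hpos : (0 : ℤ) < 2 ^ k := by positivity
  have key : ∀ b : ZMod N × β',
      (∀ p ∈ P, ∀ d : ℤ, |d| ≤ 2 ^ k → (sh d p.1 = a ↔ sh d p.2 = b)) →
      (∀ d : ℤ, |d| ≤ 2 ^ k → (sh d a = a ↔ sh d b = b)) → RelP k ((a, b) :: P) := by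
    intro b h1 h2 p hp p' hp' d hd
    rcases List.mem_cons.1 hp with rfl | hp <;> rcases List.mem_cons.1 hp' with rfl | hp'
    · exact h2 d hd
    · have := h1 p' hp' (-d) (by simpa using hd)
      have e1 := sh_eq_iff (-d) 0 p'.1 a
      have e2 := sh_eq_iff 0 d p'.1 a
      have e3 := sh_eq_iff (-d) 0 p'.2 b
      have e4 := sh_eq_iff 0 d p'.2 b
      simp only [sh_zero, sub_zero, zero_sub] at e1 e2 e3 e4
      constructor
      · intro hh
        exact (e4.2 (this.1 (e2.1 hh.symm))).symm
      · intro hh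
        exact (e2.2 (this.2 (e4.1 hh.symm))).symm
    · exact h1 p hp d hd
    · exact h p hp p' hp' d (by rw [hpow]; linarith)
  by_cases hc : ∃ p ∈ P, ∃ d : ℤ, |d| ≤ 2 ^ k ∧ sh d p.1 = a
  · obtain ⟨p, hp, d, hd, rfl⟩ := hc
    refine ⟨sh d p.2, key _ ?_ ?_⟩
    · intro p' hp' e he
      rw [sh_eq_iff, sh_eq_iff]
      refine h p' hp' p hp _ ?_
      rw [hpow]
      exact (abs_sub _ _).trans (by linarith)
    · intro e he
      rw [sh_self_iff, sh_self_iff]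
  · push Not at hc
    have : NeZero N := ⟨by omega⟩
    obtain ⟨y0⟩ := ‹Nonempty β'›
    have hfar : ∃ b : ZMod N × β', ∀ p ∈ P, ∀ d : ℤ, |d| ≤ 2 ^ k → sh d p.2 ≠ b := by
      let bad : Finset (ZMod N) :=
        (P.toFinset ×ˢ Finset.Icc (-(2 : ℤ) ^ k) (2 ^ k)).image (fun z => (sh z.2 z.1.2).1)
      have hcard : bad.card < (Finset.univ : Finset (ZMod N)).card := by
        rw [Finset.card_univ, ZMod.card]
        refine lt_of_le_of_lt ?_ hN
        refine Finset.card_image_le.trans ?_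
        rw [Finset.card_product]
        refine Nat.mul_le_mul ?_ ?_
        · exact (List.toFinset_card_le _).trans (by omega)
        · rw [Int.card_Icc]
          have h3 : (2 : ℕ) ^ (k + 1) ≤ 2 ^ K := Nat.pow_le_pow_right (by norm_num) (by omega)
          have h4 : ((2 : ℕ) : ℤ) ^ (k + 1) ≤ ((2 : ℕ) : ℤ) ^ K := by exact_mod_cast h3
          have h5 : ((2 ^ K + 1 : ℕ) : ℤ) = 2 ^ K + 1 := by push_cast; ring
          rw [Int.toNat_le, h5]
          push_cast at h4
          rw [hpow] at h4
          linarith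
      obtain ⟨b, _, hb⟩ := Finset.exists_mem_notMem_of_card_lt_card hcard
      refine ⟨(b, y0), fun p hp d hd hh => hb ?_⟩
      refine Finset.mem_image.2 ⟨(p, d), ?_, by rw [hh]⟩
      simp only [Finset.mem_product, List.mem_toFinset, Finset.mem_Icc]
      exact ⟨hp, abs_le.1 hd⟩
    obtain ⟨b, hb⟩ := hfar
    refine ⟨b, key b ?_ ?_⟩
    · intro p hp d hd
      exact ⟨fun hh => absurd hh (hc p hp d hd), fun hh => absurd hh (hb p hp d hd)⟩
    · intro d hd
      rw [sh_self_iff, sh_self_iff]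

/-! ### The cycle ABoxes -/

section cyc
variable {σ α β : Type} {N : ℕ}

/-- The embedding of the copy at `p` into the cycle, gluing `y` at `p` with `x` at `p + 1`. -/
noncomputable def glue (x y : α) (p : ZMod N × β) (w : α) : (ZMod N × β) × α :=
  if w = y then (sh 1 p, x) else (p, w)

def cycBox (D : Set (At σ α)) (x y : α) (s t : ZMod N × β) :
    Set (At σ ((ZMod N × β) × α)) :=
  {a | (∃ p : ZMod N × β, ∃ b ∈ D, b ≠ At.F x ∧ b ≠ At.T y ∧ a = At.map (glue x y p) b) ∨
    (∃ p : ZMod N × β, a = At.A (p, x)) ∨ a = At.T (s, x) ∨ a = At.F (t, x)}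

theorem glue_ne {x y : α} {p : ZMod N × β} {w : α} (h : w ≠ y) : glue x y p w = (p, w) := by
  simp [glue, h]

theorem glue_y {x y : α} {p : ZMod N × β} : glue x y p y = (sh 1 p, x) := by
  simp [glue]

theorem mem_F {D : Set (At σ α)} {x y : α} {s t p : ZMod N × β} {v : α} (hy : At.F y ∉ D) :
    At.F (p, v) ∈ cycBox D x y s t ↔ (At.F v ∈ D ∧ v ≠ x) ∨ (p = t ∧ v = x) := by
  constructor
  · rintro (⟨p', b, hb, h1, h2, h3⟩ | ⟨p', h⟩ | h | h)
    · cases b with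
      | F w =>
        have hw : w ≠ y := by rintro rfl; exact hy hb
        simp only [At.map, glue_ne hw, At.F.injEq, Prod.mk.injEq] at h3
        obtain ⟨rfl, rfl⟩ := h3
        exact Or.inl ⟨hb, by rintro rfl; exact h1 rfl⟩
      | T w => simp [At.map] at h3
      | A w => simp [At.map] at h3
      | R r w w' => simp [At.map] at h3
    · simp at h
    · simp at h
    · simp only [At.F.injEq, Prod.mk.injEq] at h
      exact Or.inr h
  · rintro (⟨h1, h2⟩ | ⟨rfl, rfl⟩)
    · have hw : v ≠ y := by rintro rfl; exact hy h1
      exact Or.inl ⟨p, At.F v, h1, by simpa using h2, by simp, by simp [At.map, glue_ne hw]⟩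
    · exact Or.inr (Or.inr (Or.inr rfl))

theorem mem_T {D : Set (At σ α)} {x y : α} {s t p : ZMod N × β} {v : α} :
    At.T (p, v) ∈ cycBox D x y s t ↔ (At.T v ∈ D ∧ v ≠ y) ∨ (p = s ∧ v = x) := by
  constructor
  · rintro (⟨p', b, hb, h1, h2, h3⟩ | ⟨p', h⟩ | h | h)
    · cases b with
      | T w =>
        have hw : w ≠ y := by rintro rfl; exact h2 rfl
        simp only [At.map, glue_ne hw, At.T.injEq, Prod.mk.injEq] at h3
        obtain ⟨rfl, rfl⟩ := h3
        exact Or.inl ⟨hb, hw⟩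
      | F w => simp [At.map] at h3
      | A w => simp [At.map] at h3
      | R r w w' => simp [At.map] at h3
    · simp at h
    · simp only [At.T.injEq, Prod.mk.injEq] at h
      exact Or.inr h
    · simp at h
  · rintro (⟨h1, h2⟩ | ⟨rfl, rfl⟩)
    · exact Or.inl ⟨p, At.T v, h1, by simp, by simpa using h2, by simp [At.map, glue_ne h2]⟩
    · exact Or.inr (Or.inr (Or.inl rfl))

theorem mem_A {D : Set (At σ α)} {x y : α} {s t p : ZMod N × β} {v : α} :
    At.A (p, v) ∈ cycBox D x y s t ↔ (At.A v ∈ D ∧ v ≠ y) ∨ v = x := by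
  constructor
  · rintro (⟨p', b, hb, h1, h2, h3⟩ | ⟨p', h⟩ | h | h)
    · cases b with
      | A w =>
        by_cases hw : w = y
        · subst hw
          simp only [At.map, glue_y, At.A.injEq, Prod.mk.injEq] at h3
          exact Or.inr h3.2
        · simp only [At.map, glue_ne hw, At.A.injEq, Prod.mk.injEq] at h3
          obtain ⟨rfl, rfl⟩ := h3
          exact Or.inl ⟨hb, hw⟩
      | F w => simp [At.map] at h3
      | T w => simp [At.map] at h3
      | R r w w' => simp [At.map] at h3
    · simp only [At.A.injEq, Prod.mk.injEq] at h
      exact Or.inr h.2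
    · simp at h
    · simp at h
  · rintro (⟨h1, h2⟩ | rfl)
    · exact Or.inl ⟨p, At.A v, h1, by simp, by simp, by simp [At.map, glue_ne h2]⟩
    · exact Or.inr (Or.inl ⟨p, rfl⟩)

/-- Offset of a node within its copy. -/
noncomputable def off (y w : α) : ℤ := if w = y then 1 else 0

/-- Identification of `y` with `x`. -/
noncomputable def rho (x y w : α) : α := if w = y then x else w

theorem glue_eq (x y : α) (p : ZMod N × β) (w : α) :
    glue x y p w = (sh (off y w) p, rho x y w) := by
  by_cases h : w = y <;> simp [glue, off, rho, h, sh_zero]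

theorem mem_R {D : Set (At σ α)} {x y : α} {s t p p' : ZMod N × β} {r : σ} {v v' : α} :
    At.R r (p, v) (p', v') ∈ cycBox D x y s t ↔
      ∃ w w', At.R r w w' ∈ D ∧ rho x y w = v ∧ rho x y w' = v' ∧
        sh (off y w' - off y w) p = p' := by
  constructor
  · rintro (⟨p0, b, hb, h1, h2, h3⟩ | ⟨p', h⟩ | h | h)
    · cases b with
      | R r0 w w' =>
        simp only [At.map, glue_eq, At.R.injEq, Prod.mk.injEq] at h3
        obtain ⟨rfl, ⟨rfl, rfl⟩, rfl, rfl⟩ := h3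
        refine ⟨w, w', hb, rfl, rfl, ?_⟩
        rw [sh_sh]
        congr 1
        ring
      | F w => simp [At.map] at h3
      | T w => simp [At.map] at h3
      | A w => simp [At.map] at h3
    · simp at h
    · simp at h
    · simp at h
  · rintro ⟨w, w', hb, rfl, rfl, rfl⟩
    refine Or.inl ⟨sh (-off y w) p, At.R r w w', hb, by simp, by simp, ?_⟩
    simp only [At.map, glue_eq, At.R.injEq, Prod.mk.injEq, sh_sh, true_and, and_true]
    refine ⟨by simp [sh_zero], ?_⟩
    congr 1
    ring

theorem off_abs (y w w' : α) (k : ℕ) : |off y w' - off y w| ≤ 2 ^ k := by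
  have h1 : (1 : ℤ) ≤ 2 ^ k := one_le_pow₀ (by norm_num)
  refine le_trans ?_ h1
  unfold off
  split_ifs <;> simp

theorem indSet_cyc {β' : Type} {D : Set (At σ α)} {x y : α} {s t p : ZMod N × β}
    {s' t' : ZMod N × β'} {v : α}
    (h : (p, v) ∈ indSet (cycBox D x y s t)) (p' : ZMod N × β') :
    (p', v) ∈ indSet (cycBox D x y s' t') := by
  have hx : v = x → (p', v) ∈ indSet (cycBox D x y s' t') := by
    rintro rfl
    exact ⟨At.A (p', v), mem_A.2 (Or.inr rfl), by simp [At.vars]⟩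
  obtain ⟨a, (⟨p0, b, hb, h1, h2, rfl⟩ | ⟨p0, rfl⟩ | rfl | rfl), hv⟩ := h
  · obtain ⟨w, hw, hw'⟩ := (mem_vars_map _ _ _).1 hv
    by_cases hwy : w = y
    · subst hwy
      rw [glue_y] at hw'
      exact hx (congrArg Prod.snd hw').symm
    · rw [glue_ne hwy] at hw'
      obtain rfl : w = v := congrArg Prod.snd hw'
      exact ⟨_, Or.inl ⟨p', b, hb, h1, h2, rfl⟩, (mem_vars_map _ _ _).2 ⟨w, hw, glue_ne hwy⟩⟩
  all_goals
    simp only [At.vars, Set.mem_singleton_iff, Prod.mk.injEq] at hv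
    exact hx hv.2

theorem cycBox_finite [NeZero N] [Finite β] {D : Set (At σ α)} (hD : D.Finite) (x y : α)
    (s t : ZMod N × β) : (cycBox D x y s t).Finite := by
  have h1 : (Set.image2 (fun (p : ZMod N × β) b => At.map (glue x y p) b) Set.univ D ∪
      (Set.range (fun p : ZMod N × β => (At.A (p, x) : At σ _)) ∪
        {At.T (s, x), At.F (t, x)})).Finite :=
    (Set.Finite.image2 _ Set.finite_univ hD).union ((Set.finite_range _).union (by simp))
  refine h1.subset ?_
  rintro a (⟨p, b, hb, _, _, rfl⟩ | ⟨p, rfl⟩ | rfl | rfl)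
  · exact Or.inl ⟨p, trivial, b, hb, rfl⟩
  · exact Or.inr (Or.inl ⟨p, rfl⟩)
  · simp
  · simp

end cyc

/-- The back-and-forth relation between two cycle ABoxes. -/
def cycRel {σ α β β' : Type} {N : ℕ} (K : ℕ) (D : Set (At σ α)) (x y : α)
    (s t : ZMod N × β) (s' t' : ZMod N × β') (n k : ℕ)
    (a : Fin n → indSet (cycBox D x y s t)) (b : Fin n → indSet (cycBox D x y s' t')) : Prop :=
  ∃ P : List ((ZMod N × β) × (ZMod N × β')), P.length + k ≤ K ∧ RelP k P ∧
    (s, s') ∈ P ∧ (t, t') ∈ P ∧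
    ∀ i, (a i).1.2 = (b i).1.2 ∧ ((a i).1.1, (b i).1.1) ∈ P

theorem cycRel.swap {σ α β β' : Type} {N : ℕ} {K : ℕ} {D : Set (At σ α)} {x y : α}
    {s t : ZMod N × β} {s' t' : ZMod N × β'} {n k : ℕ}
    {a : Fin n → indSet (cycBox D x y s t)} {b : Fin n → indSet (cycBox D x y s' t')}
    (h : cycRel K D x y s t s' t' n k a b) : cycRel K D x y s' t' s t n k b a := by
  obtain ⟨P, h1, h2, h3, h4, h5⟩ := h
  refine ⟨P.map Prod.swap, by simpa using h1, h2.swap, List.mem_map.2 ⟨_, h3, rfl⟩,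
    List.mem_map.2 ⟨_, h4, rfl⟩, fun i => ⟨(h5 i).1.symm, List.mem_map.2 ⟨_, (h5 i).2, rfl⟩⟩⟩

theorem cycRel.forth {σ α β β' : Type} [Nonempty β'] {N : ℕ} {K : ℕ} {D : Set (At σ α)} {x y : α}
    (hN : K * (2 ^ K + 1) < N)
    {s t : ZMod N × β} {s' t' : ZMod N × β'} {n k : ℕ}
    {a : Fin n → indSet (cycBox D x y s t)} {b : Fin n → indSet (cycBox D x y s' t')}
    (h : cycRel K D x y s t s' t' n (k + 1) a b) (u : indSet (cycBox D x y s t)) :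
    ∃ u' : indSet (cycBox D x y s' t'), cycRel K D x y s t s' t' (n + 1) k
      (Fin.snoc (α := fun _ => indSet (cycBox D x y s t)) a u)
      (Fin.snoc (α := fun _ => indSet (cycBox D x y s' t')) b u') := by
  obtain ⟨P, h1, h2, h3, h4, h5⟩ := h
  obtain ⟨p', hp'⟩ := h2.extend hN h1 u.1.1
  refine ⟨⟨(p', u.1.2), indSet_cyc u.2 p'⟩, (u.1.1, p') :: P, ?_, hp', ?_, ?_, ?_⟩
  · simp only [List.length_cons]; omega
  · exact List.mem_cons_of_mem _ h3
  · exact List.mem_cons_of_mem _ h4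
  · intro i
    refine Fin.lastCases ?_ (fun j => ?_) i
    · simp
    · simp only [Fin.snoc_castSucc]
      exact ⟨(h5 j).1, List.mem_cons_of_mem _ (h5 j).2⟩

theorem RelP.eq_iff {N : ℕ} {β β' : Type} {k : ℕ} {P : List ((ZMod N × β) × (ZMod N × β'))}
    (h : RelP k P) {a b : ZMod N × β} {a' b' : ZMod N × β'} (ha : (a, a') ∈ P)
    (hb : (b, b') ∈ P) : a = b ↔ a' = b' := by
  have := h _ ha _ hb 0 (by simp)
  simpa [sh_zero] using this

theorem cyc_equiv {σ α β β' : Type} [Nonempty β] [Nonempty β'] {N : ℕ} {K : ℕ}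
    {D : Set (At σ α)} {x y : α} (hy : At.F y ∉ D)
    (hN : K * (2 ^ K + 1) < N)
    {s t : ZMod N × β} {s' t' : ZMod N × β'} (Φ : (Lsig σ).Sentence)
    (hK : 2 + qdepth Φ ≤ K) (hP : RelP (qdepth Φ) [(s, s'), (t, t')]) :
    foHolds (cycBox D x y s t) Φ ↔ foHolds (cycBox D x y s' t') Φ := by
  unfold foHolds FirstOrder.Language.Sentence.Realize FirstOrder.Language.Formula.Realize
  refine back_forth (restrictI (cycBox D x y s t)) (restrictI (cycBox D x y s' t'))
    (fun n k a b => cycRel K D x y s t s' t' n k a b) ?_ ?_ ?_ ?_ ?_ ?_ ?_ Φ (qdepth Φ) _ _ _ _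
    le_rfl ⟨_, by simpa [add_comm] using hK, hP, by simp, by simp, fun i => i.elim0⟩
  · rintro n k a b ⟨P, h1, h2, h3, h4, h5⟩ i j
    rw [Subtype.ext_iff, Subtype.ext_iff, Prod.ext_iff (x := (a i).1), Prod.ext_iff (x := (b i).1), (h5 i).1, (h5 j).1,
      h2.eq_iff (h5 i).2 (h5 j).2]
  · rintro n k a b ⟨P, h1, h2, h3, h4, h5⟩ i
    show At.F ((a i).1.1, (a i).1.2) ∈ _ ↔ At.F ((b i).1.1, (b i).1.2) ∈ _
    rw [mem_F hy, mem_F hy, (h5 i).1, h2.eq_iff (h5 i).2 h4]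
  · rintro n k a b ⟨P, h1, h2, h3, h4, h5⟩ i
    show At.T ((a i).1.1, (a i).1.2) ∈ _ ↔ At.T ((b i).1.1, (b i).1.2) ∈ _
    rw [mem_T, mem_T, (h5 i).1, h2.eq_iff (h5 i).2 h3]
  · rintro n k a b ⟨P, h1, h2, h3, h4, h5⟩ i
    show At.A ((a i).1.1, (a i).1.2) ∈ _ ↔ At.A ((b i).1.1, (b i).1.2) ∈ _
    rw [mem_A, mem_A, (h5 i).1]
  · rintro n k a b ⟨P, h1, h2, h3, h4, h5⟩ r i j
    show At.R r ((a i).1.1, (a i).1.2) ((a j).1.1, (a j).1.2) ∈ _ ↔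
      At.R r ((b i).1.1, (b i).1.2) ((b j).1.1, (b j).1.2) ∈ _
    rw [mem_R, mem_R, (h5 i).1, (h5 j).1]
    refine exists_congr fun w => exists_congr fun w' => ?_
    rw [h2 _ (h5 i).2 _ (h5 j).2 _ (off_abs y w w' k)]
  · intro n k a b h u
    exact h.forth hN u
  · intro n k a b h u
    obtain ⟨z, hz⟩ := h.swap.forth hN u
    exact ⟨z, hz.swap⟩

/-! ### Minimal certain ABoxes -/

/-- The `F`- and `T`-atoms of an ABox. -/
def labels {σ α : Type} (D : Set (At σ α)) : Set (At σ α) :=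
  {a | a ∈ D ∧ ∃ v, a = At.F v ∨ a = At.T v}

/-- Identify `y` with `x` and drop the atom `e`. -/
def quo {σ α : Type} (D : Set (At σ α)) (x y : α) (e : At σ α) : Set (At σ α) :=
  {a | ∃ b ∈ D, b ≠ e ∧ a = At.map (rho x y) b}

theorem quo_finite {σ α : Type} {D : Set (At σ α)} (hD : D.Finite) (x y : α) (e : At σ α) :
    (quo D x y e).Finite := by
  refine (hD.image (At.map (rho x y))).subset ?_
  rintro a ⟨b, hb, _, rfl⟩
  exact ⟨b, hb, rfl⟩

theorem quo_card {σ α : Type} {D : Set (At σ α)} (hD : D.Finite) (x y : α) {e : At σ α}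
    (he : e ∈ labels D) : (labels (quo D x y e)).ncard < (labels D).ncard := by
  have hfin : (labels D).Finite := hD.subset fun a h => h.1
  have hsub : labels (quo D x y e) ⊆ At.map (rho x y) '' (labels D \ {e}) := by
    rintro a ⟨⟨b, hb, hbe, rfl⟩, v, hv⟩
    refine ⟨b, ⟨⟨hb, ?_⟩, hbe⟩, rfl⟩
    cases b with
    | F w => exact ⟨w, Or.inl rfl⟩
    | T w => exact ⟨w, Or.inr rfl⟩
    | A w => simp [At.map] at hv
    | R r w w' => simp [At.map] at hv
  calc (labels (quo D x y e)).ncard ≤ (At.map (rho x y) '' (labels D \ {e})).ncard :=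
        Set.ncard_le_ncard hsub (hfin.sdiff.image _)
    _ ≤ (labels D \ {e}).ncard := Set.ncard_image_le hfin.sdiff
    _ < (labels D).ncard := Set.ncard_sdiff_singleton_lt_of_mem he hfin

theorem rho_ne {α : Type} {x y w : α} (h : w ≠ y) : rho x y w = w := by simp [rho, h]

theorem rho_y {α : Type} {x y : α} : rho x y y = x := by simp [rho]

section
variable {σ α : Type} {D : Set (At σ α)} {x y : α}

theorem quo_F {e : At σ α} {v : α} (hy : At.F y ∉ D) :
    At.F v ∈ quo D x y e ↔ At.F v ∈ D ∧ At.F v ≠ e := by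
  constructor
  · rintro ⟨b, hb, h1, h3⟩
    cases b with
    | F w =>
      have hw : w ≠ y := by rintro rfl; exact hy hb
      simp only [At.map, rho_ne hw, At.F.injEq] at h3
      subst h3
      exact ⟨hb, h1⟩
    | T w => simp [At.map] at h3
    | A w => simp [At.map] at h3
    | R r w w' => simp [At.map] at h3
  · rintro ⟨h1, h2⟩
    have hw : v ≠ y := by rintro rfl; exact hy h1
    exact ⟨_, h1, h2, by simp [At.map, rho_ne hw]⟩

theorem quo_T {e : At σ α} {v : α} :
    At.T v ∈ quo D x y e ↔ (At.T v ∈ D ∧ v ≠ y ∧ At.T v ≠ e) ∨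
      (v = x ∧ At.T y ∈ D ∧ At.T y ≠ e) := by
  constructor
  · rintro ⟨b, hb, h1, h3⟩
    cases b with
    | T w =>
      by_cases hw : w = y
      · subst hw
        simp only [At.map, rho_y, At.T.injEq] at h3
        exact Or.inr ⟨h3, hb, h1⟩
      · simp only [At.map, rho_ne hw, At.T.injEq] at h3
        subst h3
        exact Or.inl ⟨hb, hw, h1⟩
    | F w => simp [At.map] at h3
    | A w => simp [At.map] at h3
    | R r w w' => simp [At.map] at h3
  · rintro (⟨h1, h2, h3⟩ | ⟨rfl, h1, h2⟩)
    · exact ⟨_, h1, h3, by simp [At.map, rho_ne h2]⟩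
    · exact ⟨_, h1, h2, by simp [At.map, rho_y]⟩

theorem quo_A {e : At σ α} {v : α} (h : At.A v ∈ D) (hv : v ≠ y) (he : At.A v ≠ e) :
    At.A v ∈ quo D x y e :=
  ⟨_, h, he, by simp [At.map, rho_ne hv]⟩

/-- The labelled cycle box maps into the quotient. -/
theorem not_cert_two {V : Type} {N : ℕ} {q : Set (At σ V)} (hqne : q.Nonempty)
    (hqA : noA q) (hqconn : connCQ q)
    (htw : twinFree D) (hx : At.F x ∈ D) (hy : At.T y ∈ D)
    (hT : ¬ covABotCert (quo D x y (At.F x)) q) (hF : ¬ covABotCert (quo D x y (At.T y)) q)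
    (i j : ZMod N) :
    ¬ covABotCert (cycBox D x y ((i, true) : ZMod N × Bool) (j, false)) q := by
  have hyF : At.F y ∉ D := fun h => htw y ⟨h, hy⟩
  have hxT : At.T x ∉ D := fun h => htw x ⟨hx, h⟩
  have hxy : x ≠ y := by rintro rfl; exact hxT hy
  unfold covABotCert at hT hF
  push Not at hT hF
  obtain ⟨cT, -, hcT⟩ := hT
  obtain ⟨cF, -, hcF⟩ := hF
  intro hcert
  have htw' : twinFree (cycBox D x y ((i, true) : ZMod N × Bool) (j, false)) := by
    rintro ⟨p, v⟩ ⟨h1, h2⟩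
    rw [mem_F hyF] at h1
    rw [mem_T] at h2
    rcases h1 with ⟨h1, h1'⟩ | ⟨h1, rfl⟩ <;> rcases h2 with ⟨h2, h2'⟩ | ⟨h2, h2'⟩
    · exact htw v ⟨h1, h2⟩
    · exact h1' h2'
    · exact hxT h2
    · rw [h1] at h2; simp at h2
  let c : (ZMod N × Bool) × α → Bool := fun z =>
    if z.2 = x then !z.1.2 else if z.1.2 then cT z.2 else cF z.2
  obtain ⟨h, hh⟩ := hcert c (disjoint_of_twinFree htw' c)
  obtain ⟨a0, ha0⟩ := hqne
  obtain ⟨v0, hv0⟩ := vars_nonempty a0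
  have hb : ∀ v, occ q v → (h v).1.2 = (h v0).1.2 := by
    intro v hv
    have hstep := hqconn v0 v ⟨a0, ha0, hv0⟩ hv
    clear hv
    induction hstep with
    | refl => rfl
    | @tail u w _ huw ih =>
      rw [← ih]
      obtain ⟨a, ha, hu, hw⟩ := huw
      have h1 := hh a ha
      cases a with
      | F z =>
        simp only [At.vars, Set.mem_singleton_iff] at hu hw
        rw [hu, hw]
      | T z =>
        simp only [At.vars, Set.mem_singleton_iff] at hu hw
        rw [hu, hw]
      | A z =>
        simp only [At.vars, Set.mem_singleton_iff] at hu hw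
        rw [hu, hw]
      | R r z z' =>
        have h2 : At.R r ((h z).1, (h z).2) ((h z').1, (h z').2) ∈
          cycBox D x y ((i, true) : ZMod N × Bool) (j, false) := h1
        rw [mem_R] at h2
        obtain ⟨_, _, _, _, _, h3⟩ := h2
        have h4 : (h z).1.2 = (h z').1.2 := by
          rw [← h3]
          rfl
        simp only [At.vars, Set.mem_insert_iff, Set.mem_singleton_iff] at hu hw
        rcases hu with rfl | rfl <;> rcases hw with rfl | rfl <;> simp [h4]
  -- the projection
  have hRR : ∀ (e : At σ α), (∀ r v w, e ≠ At.R r v w) → ∀ r (d d' : (ZMod N × Bool) × α),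
      At.R r d d' ∈ cycBox D x y ((i, true) : ZMod N × Bool) (j, false) →
      At.R r d.2 d'.2 ∈ quo D x y e := by
    rintro e he r ⟨p, v⟩ ⟨p', v'⟩ hd
    rw [mem_R] at hd
    obtain ⟨w, w', h1, rfl, rfl, -⟩ := hd
    exact ⟨_, h1, (he _ _ _).symm, rfl⟩
  cases hb0 : (h v0).1.2 with
  | true =>
    apply hcT
    refine satCQ_of_hom hqA Prod.snd h hh (fun z => z.1.2 = true)
      (fun v hv => (hb v hv).trans hb0) ?_ ?_ ?_
    · rintro ⟨p, v⟩ hp (h1 | ⟨h1, h2⟩)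
      · left
        rw [mem_F hyF] at h1
        rcases h1 with ⟨h1, h1'⟩ | ⟨rfl, rfl⟩
        · exact (quo_F hyF).2 ⟨h1, by simpa using h1'⟩
        · simp at hp
      · obtain ⟨hA, hnF, hnT⟩ := h1
        rw [mem_A] at hA
        rw [mem_F hyF] at hnF
        rw [mem_T] at hnT
        have hp' : p.2 = true := hp
        have hvx : v ≠ x := by
          rintro rfl
          simp [c, hp'] at h2
        have hA' := hA.resolve_right hvx
        right
        refine ⟨⟨quo_A hA'.1 hA'.2 (by simp), ?_, ?_⟩, ?_⟩
        · rw [quo_F hyF]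
          exact fun hf => hnF (Or.inl ⟨hf.1, hvx⟩)
        · rw [quo_T]
          rintro (hf | hf)
          · exact hnT (Or.inl ⟨hf.1, hf.2.1⟩)
          · exact hvx hf.1
        · simpa [c, hp', hvx] using h2
    · rintro ⟨p, v⟩ hp (h1 | ⟨h1, h2⟩)
      · left
        rw [mem_T] at h1
        rcases h1 with ⟨h1, h1'⟩ | ⟨rfl, rfl⟩
        · exact quo_T.2 (Or.inl ⟨h1, h1', by simp⟩)
        · exact quo_T.2 (Or.inr ⟨rfl, hy, by simp⟩)
      · obtain ⟨hA, hnF, hnT⟩ := h1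
        rw [mem_A] at hA
        rw [mem_F hyF] at hnF
        rw [mem_T] at hnT
        have hp' : p.2 = true := hp
        by_cases hvx : v = x
        · left
          exact quo_T.2 (Or.inr ⟨hvx, hy, by simp⟩)
        have hA' := hA.resolve_right hvx
        right
        refine ⟨⟨quo_A hA'.1 hA'.2 (by simp), ?_, ?_⟩, ?_⟩
        · rw [quo_F hyF]
          exact fun hf => hnF (Or.inl ⟨hf.1, hvx⟩)
        · rw [quo_T]
          rintro (hf | hf)
          · exact hnT (Or.inl ⟨hf.1, hf.2.1⟩)
          · exact hvx hf.1
        · simpa [c, hp', hvx] using h2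
    · intro r d d' _ _ hd
      exact hRR _ (by simp) _ _ _ hd
  | false =>
    apply hcF
    refine satCQ_of_hom hqA Prod.snd h hh (fun z => z.1.2 = false)
      (fun v hv => (hb v hv).trans hb0) ?_ ?_ ?_
    · rintro ⟨p, v⟩ hp (h1 | ⟨h1, h2⟩)
      · left
        rw [mem_F hyF] at h1
        rcases h1 with ⟨h1, h1'⟩ | ⟨rfl, rfl⟩
        · exact (quo_F hyF).2 ⟨h1, by simp⟩
        · exact (quo_F hyF).2 ⟨hx, by simp⟩
      · obtain ⟨hA, hnF, hnT⟩ := h1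
        rw [mem_A] at hA
        rw [mem_F hyF] at hnF
        rw [mem_T] at hnT
        have hp' : p.2 = false := hp
        by_cases hvx : v = x
        · left
          exact (quo_F hyF).2 ⟨by rw [hvx]; exact hx, by simp⟩
        have hA' := hA.resolve_right hvx
        right
        refine ⟨⟨quo_A hA'.1 hA'.2 (by simp), ?_, ?_⟩, ?_⟩
        · rw [quo_F hyF]
          exact fun hf => hnF (Or.inl ⟨hf.1, hvx⟩)
        · rw [quo_T]
          rintro (hf | hf)
          · exact hnT (Or.inl ⟨hf.1, hf.2.1⟩)
          · exact hvx hf.1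
        · simpa [c, hp', hvx] using h2
    · rintro ⟨p, v⟩ hp (h1 | ⟨h1, h2⟩)
      · left
        rw [mem_T] at h1
        rcases h1 with ⟨h1, h1'⟩ | ⟨rfl, rfl⟩
        · exact quo_T.2 (Or.inl ⟨h1, h1', by simpa using h1'⟩)
        · simp at hp
      · obtain ⟨hA, hnF, hnT⟩ := h1
        rw [mem_A] at hA
        rw [mem_F hyF] at hnF
        rw [mem_T] at hnT
        have hp' : p.2 = false := hp
        have hvx : v ≠ x := by
          rintro rfl
          simp [c, hp'] at h2
        have hA' := hA.resolve_right hvx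
        right
        refine ⟨⟨quo_A hA'.1 hA'.2 (by simp), ?_, ?_⟩, ?_⟩
        · rw [quo_F hyF]
          exact fun hf => hnF (Or.inl ⟨hf.1, hvx⟩)
        · rw [quo_T]
          rintro (hf | hf)
          · exact hnT (Or.inl ⟨hf.1, hf.2.1⟩)
          · exact hvx hf.1
        · simpa [c, hp', hvx] using h2
    · intro r d d' _ _ hd
      exact hRR _ (by simp) _ _ _ hd

/-- The single cycle is a yes-instance. -/
theorem cert_one {V : Type} {N : ℕ} [NeZero N] {q : Set (At σ V)}
    (hqA : noA q) (htw : twinFree D) (hx : At.F x ∈ D) (hy : At.T y ∈ D)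
    (hD : covABotCert D q) (i j : ZMod N) :
    covABotCert (cycBox D x y ((i, ()) : ZMod N × Unit) (j, ())) q := by
  have hyF : At.F y ∉ D := fun h => htw y ⟨h, hy⟩
  have hxT : At.T x ∉ D := fun h => htw x ⟨hx, h⟩
  have hxy : x ≠ y := by rintro rfl; exact hxT hy
  intro c hdis
  set E := cycBox D x y ((i, ()) : ZMod N × Unit) (j, ()) with hE
  have hcov : ∀ z, At.A z ∈ E → (minModel E c).FS z ∨ (minModel E c).TS z := by
    intro z hz
    by_cases h1 : At.F z ∈ E
    · exact Or.inl (Or.inl h1)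
    by_cases h2 : At.T z ∈ E
    · exact Or.inr (Or.inl h2)
    cases hc : c z with
    | true => exact Or.inl (Or.inr ⟨⟨hz, h1, h2⟩, hc⟩)
    | false => exact Or.inr (Or.inr ⟨⟨hz, h1, h2⟩, hc⟩)
  have hAx : ∀ p, At.A (p, x) ∈ E := fun p => mem_A.2 (Or.inr rfl)
  have hex : ∃ p : ZMod N × Unit, (minModel E c).FS (p, x) ∧ ¬ (minModel E c).FS (sh 1 p, x) := by
    by_contra hno
    push Not at hno
    have hall : ∀ k : ℕ, (minModel E c).FS ((j + (k : ZMod N), ()), x) := by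
      intro k
      induction k with
      | zero =>
        left
        exact (mem_F hyF).2 (Or.inr ⟨by simp, rfl⟩)
      | succ k ih =>
        have := hno _ ih
        simpa [sh, add_assoc] using this
    have h1 := hall (i - j).val
    rw [ZMod.natCast_zmod_val, add_sub_cancel] at h1
    exact hdis ((i, ()), x) ⟨h1, Or.inl (mem_T.2 (Or.inr ⟨rfl, rfl⟩))⟩
  obtain ⟨p, hp1, hp2⟩ := hex
  have hp3 : (minModel E c).TS (sh 1 p, x) := (hcov _ (hAx _)).resolve_left hp2
  have hmem : ∀ b ∈ D, b ≠ At.F x → b ≠ At.T y → At.map (glue x y p) b ∈ E :=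
    fun b hb h1 h2 => Or.inl ⟨p, b, hb, h1, h2, rfl⟩
  let c' : α → Bool := fun v => decide ((minModel E c).FS (glue x y p v))
  obtain ⟨h, hh⟩ := hD c' (disjoint_of_twinFree htw c')
  refine satCQ_of_hom hqA (glue x y p) h hh (fun _ => True) (fun _ _ => trivial) ?_ ?_ ?_
  · rintro v - (h1 | ⟨h1, h2⟩)
    · by_cases hv : v = x
      · subst hv
        rw [glue_ne hxy]
        exact hp1
      · exact Or.inl (hmem _ h1 (by simpa using hv) (by simp))
    · simpa [c'] using h2
  · rintro v - (h1 | ⟨h1, h2⟩)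
    · by_cases hv : v = y
      · subst hv
        rw [glue_y]
        exact hp3
      · exact Or.inl (hmem _ h1 (by simp) (by simpa using hv))
    · have h3 : ¬ (minModel E c).FS (glue x y p v) := by simpa [c'] using h2
      exact (hcov _ (hmem _ h1.1 (by simp) (by simp))).resolve_left h3
  · intro r d e _ _ hd
    exact hmem _ hd (by simp) (by simp)

end

theorem hard_direction {σ V : Type} (q : Set (At σ V)) (hqfin : q.Finite) (hqne : q.Nonempty)
    (hqA : noA q) (hqconn : connCQ q) (hz : ¬ isZeroCQ q)
    (htw : ¬ ∃ x, At.F x ∈ q ∧ At.T x ∈ q) : ¬ FORewritableBot q := by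
  rintro ⟨Φ, hΦ⟩
  simp only [isZeroCQ, not_or, not_forall, not_not] at hz
  obtain ⟨⟨xq, hxq, -⟩, ⟨yq, hyq, -⟩⟩ := hz
  have hqtw : twinFree q := fun a ha => htw ⟨a, ha⟩
  have hex : ∃ n : ℕ, ∃ (α : Type) (D : Set (At σ α)), D.Finite ∧ twinFree D ∧
      covABotCert D q ∧ (labels D).ncard = n := by
    refine ⟨_, V, q, hqfin, hqtw, ?_, rfl⟩
    intro c _
    refine ⟨id, fun a ha => ?_⟩
    cases a with
    | F v => exact Or.inl ha
    | T v => exact Or.inl ha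
    | A v => exact ha
    | R r v w => exact ha
  obtain ⟨α, D, hDfin, hDtw, hDc, hDn⟩ := Nat.find_spec hex
  have hmin : ∀ D' : Set (At σ α), D'.Finite → twinFree D' →
      (labels D').ncard < (labels D).ncard → ¬ covABotCert D' q := by
    intro D' h1 h2 h3 h4
    rw [hDn] at h3
    exact Nat.find_min hex h3 ⟨α, D', h1, h2, h4, rfl⟩
  have hx : ∃ x, At.F x ∈ D := by
    by_contra hno
    push Not at hno
    obtain ⟨h, hh⟩ := hDc (fun _ => false) (disjoint_of_twinFree hDtw _)
    rcases hh _ hxq with h1 | ⟨_, h1⟩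
    · exact hno _ h1
    · simp at h1
  have hy : ∃ y, At.T y ∈ D := by
    by_contra hno
    push Not at hno
    obtain ⟨h, hh⟩ := hDc (fun _ => true) (disjoint_of_twinFree hDtw _)
    rcases hh _ hyq with h1 | ⟨_, h1⟩
    · exact hno _ h1
    · simp at h1
  obtain ⟨x, hx⟩ := hx
  obtain ⟨y, hy⟩ := hy
  have hyF : At.F y ∉ D := fun h => hDtw y ⟨h, hy⟩
  have hxT : At.T x ∉ D := fun h => hDtw x ⟨hx, h⟩
  have hT : ¬ covABotCert (quo D x y (At.F x)) q := by
    refine hmin _ (quo_finite hDfin _ _ _) ?_ (quo_card hDfin _ _ ⟨hx, x, Or.inl rfl⟩)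
    rintro v ⟨h1, h2⟩
    rw [quo_F hyF] at h1
    rw [quo_T] at h2
    rcases h2 with h2 | ⟨rfl, -⟩
    · exact hDtw v ⟨h1.1, h2.1⟩
    · exact h1.2 rfl
  have hF : ¬ covABotCert (quo D x y (At.T y)) q := by
    refine hmin _ (quo_finite hDfin _ _ _) ?_ (quo_card hDfin _ _ ⟨hy, y, Or.inr rfl⟩)
    rintro v ⟨h1, h2⟩
    rw [quo_F hyF] at h1
    rw [quo_T] at h2
    rcases h2 with h2 | ⟨_, _, h2⟩
    · exact hDtw v ⟨h1.1, h2.1⟩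
    · exact h2 rfl
  -- sizes
  obtain ⟨K, hK⟩ : ∃ K, K = 2 + qdepth Φ := ⟨_, rfl⟩
  obtain ⟨m, hm⟩ : ∃ m, m = K * (2 ^ K + 1) := ⟨_, rfl⟩
  have hm1 : 2 ^ K + 1 ≤ m := by
    rw [hm]; exact Nat.le_mul_of_pos_left _ (by omega)
  have hm2 : (2 : ℤ) ^ (qdepth Φ) < m := by
    have h1 : 2 ^ (qdepth Φ) ≤ 2 ^ K := Nat.pow_le_pow_right (by norm_num) (by omega)
    have h2 : 2 ^ (qdepth Φ) < m := by omega
    exact_mod_cast h2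
  have hmpos : 0 < m := lt_of_lt_of_le (Nat.succ_pos _) hm1
  have : NeZero (2 * m) := ⟨by omega⟩
  have hN : K * (2 ^ K + 1) < 2 * m := by omega
  let s : ZMod (2 * m) × Unit := (0, ())
  let t : ZMod (2 * m) × Unit := ((m : ZMod (2 * m)), ())
  let s' : ZMod (2 * m) × Bool := (0, true)
  let t' : ZMod (2 * m) × Bool := (0, false)
  have hndvd : ∀ d : ℤ, |d| < m → ¬ ((2 * m : ℕ) : ℤ) ∣ (m : ℤ) - d := by
    rintro d hd ⟨e, he⟩
    rw [abs_lt] at hd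
    push_cast at he
    have h1 : 0 < e := by
      by_contra hcon
      push Not at hcon
      nlinarith
    nlinarith
  have hst : ∀ d : ℤ, |d| ≤ 2 ^ qdepth Φ → sh d s ≠ t := by
    intro d hd h
    have h1 : (0 : ZMod (2 * m)) + (d : ZMod (2 * m)) = (m : ZMod (2 * m)) := congrArg Prod.fst h
    apply hndvd d (lt_of_le_of_lt hd hm2)
    rw [← ZMod.intCast_zmod_eq_zero_iff_dvd]
    push_cast
    rw [← h1]
    ring
  have hts : ∀ d : ℤ, |d| ≤ 2 ^ qdepth Φ → sh d t ≠ s := by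
    intro d hd h
    have h1 : (m : ZMod (2 * m)) + (d : ZMod (2 * m)) = 0 := congrArg Prod.fst h
    apply hndvd (-d) (by rw [abs_neg]; exact lt_of_le_of_lt hd hm2)
    rw [← ZMod.intCast_zmod_eq_zero_iff_dvd]
    push_cast
    rw [← h1]
    ring
  have hP : RelP (qdepth Φ) [(s, s'), (t, t')] := by
    intro p hp p' hp' d hd
    simp only [List.mem_cons, List.not_mem_nil, or_false] at hp hp'
    rcases hp with rfl | rfl <;> rcases hp' with rfl | rfl
    · simp only [sh_self_iff]
    · simp only [hst d hd, false_iff]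
      intro h
      have := congrArg Prod.snd h
      simp [sh, s', t'] at this
    · simp only [hts d hd, false_iff]
      intro h
      have := congrArg Prod.snd h
      simp [sh, s', t'] at this
    · simp only [sh_self_iff]
  have hequiv := cyc_equiv (D := D) (x := x) (y := y) hyF hN Φ hK.ge hP
  rw [← hΦ _ _ (cycBox_finite hDfin x y s t), ← hΦ _ _ (cycBox_finite hDfin x y s' t')] at hequiv
  exact not_cert_two hqne hqA hqconn hDtw hx hy hT hF 0 0
    (hequiv.1 (cert_one hqA hDtw hx hy hDc 0 (m : ZMod (2 * m))))

/-- A dd-sirup `(cov_A^⊥, q)` is FO-rewritable if and only if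
`q` is a `0`-CQ or `q` contains an `FT`-twin. -/
theorem statement_8 {σ V : Type}
    (q : Set (At σ V)) (hqfin : q.Finite) (hqne : q.Nonempty)
    (hqA : noA q) (hqconn : connCQ q) :
    FORewritableBot q ↔ (isZeroCQ q ∨ ∃ x, At.F x ∈ q ∧ At.T x ∈ q) := by
  constructor
  · intro h
    by_contra hno
    rw [not_or] at hno
    exact hard_direction q hqfin hqne hqA hqconn hno.1 hno.2 h
  · exact easy_direction q hqfin hqne hqA

end DS
end

section
/- There exist a constant c > 0 and a sequence of d-sirups Q_n = (cov_A, q_n), for n > 0, such that the size of q_n is bounded by a polynomial in n, every Q_n is FO-rewritable, and for all sufficiently large n every UCQ-rewriting of Q_n has size at least 2^(2^(2^(c·n))) and every PE-rewriting of Q_n has size at least 2^(2^(c·n)). -/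
attribute [local instance] Classical.propDecidable

namespace DS

open FirstOrder

/-- Positive existential formulas over the signature: built from atoms using
`∃`, `∧` and `∨` only (variables are natural numbers). -/
inductive PE (σ : Type) : Type
  | atF : ℕ → PE σ
  | atT : ℕ → PE σ
  | atA : ℕ → PE σ
  | atR : σ → ℕ → ℕ → PE σ
  | conj : PE σ → PE σ → PE σ
  | disj : PE σ → PE σ → PE σ
  | ex : ℕ → PE σ → PE σ

/-- The size of a PE formula: the number of atoms occurring in it. -/
def PE.size {σ : Type} : PE σ → ℕ
  | .atF _ => 1
  | .atT _ => 1
  | .atA _ => 1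
  | .atR _ _ _ => 1
  | .conj φ ψ => φ.size + ψ.size
  | .disj φ ψ => φ.size + ψ.size
  | .ex _ φ => φ.size

/-- Truth of a PE formula in the ABox `A` regarded as a finite relational
structure with domain `ind(A)`, under the assignment `ν`. -/
def PE.Realize {σ α : Type} (A : Set (At σ α)) : PE σ → (ℕ → α) → Prop
  | .atF n, ν => At.F (ν n) ∈ A
  | .atT n, ν => At.T (ν n) ∈ A
  | .atA n, ν => At.A (ν n) ∈ A
  | .atR r n m, ν => At.R r (ν n) (ν m) ∈ A
  | .conj φ ψ, ν => φ.Realize A ν ∧ ψ.Realize A ν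
  | .disj φ ψ, ν => φ.Realize A ν ∨ ψ.Realize A ν
  | .ex n φ, ν => ∃ a ∈ indSet A, φ.Realize A (Function.update ν n a)

/-- `Φ` is an FO-rewriting of the d-sirup `(cov_A, q)`. -/
def isFORewritingA {σ V : Type} (q : Set (At σ V)) (Φ : (Lsig σ).Sentence) : Prop :=
  ∀ (α : Type) (A : Set (At σ α)), A.Finite → (covACert A q ↔ foHolds A Φ)

/-- The family `f i` (`i < k`) of Boolean CQs is a UCQ-rewriting of `(cov_A, q)`. -/
def isUCQRewritingA {σ V : Type} (q : Set (At σ V)) (k : ℕ) (f : Fin k → Set (At σ ℕ)) : Prop :=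
  (∀ i, (f i).Finite) ∧
    ∀ (α : Type) (A : Set (At σ α)), A.Finite →
      (covACert A q ↔ ∃ i, (toInterp A).satCQ (f i))

/-- The PE formula `φ` is a PE-rewriting of `(cov_A, q)`. -/
def isPERewritingA {σ V : Type} (q : Set (At σ V)) (φ : PE σ) : Prop :=
  ∀ (α : Type) (A : Set (At σ α)), A.Finite → ∀ ν : ℕ → α,
    (covACert A q ↔ φ.Realize A ν)

/-! ### Helper development -/

/-- Nodes of the query. -/
inductive Nd (I Θ : Type) : Type
  | x : Nd I Θ
  | y : I → Nd I Θ
  | u : Θ → ℕ → Nd I Θ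
  | t : I → Θ → Nd I Θ
  | s : Θ → Nd I Θ
  | w : Nd I Θ
  | W : Nd I Θ

/-- Binary relation symbols: `none` is the generic child edge, `inl i` the `i`-child edge,
`inr θ` the edge to the test `θ`. -/
abbrev RelS (I Θ : Type) : Type := Option (I ⊕ Θ)

/-- Binary atoms of the query. -/
inductive Edge {I Θ : Type} (g : Θ → ℕ) (b : Θ → I) (Pat : I → Θ → Prop) :
    RelS I Θ → Nd I Θ → Nd I Θ → Prop
  | xY (i : I) : Edge g b Pat (some (Sum.inl i)) .x (.y i)
  | xA (i : I) : Edge g b Pat none .x (.y i)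
  | xR (θ : Θ) : Edge g b Pat (some (Sum.inr θ)) .x (.u θ 0)
  | uA (θ : Θ) (k : ℕ) : k ≤ g θ + 1 → k ≠ g θ → Edge g b Pat none (.u θ k) (.u θ (k+1))
  | uY (θ : Θ) : Edge g b Pat (some (Sum.inl (b θ))) (.u θ (g θ)) (.u θ (g θ + 1))
  | tY (a : I) (θ : Θ) (i : I) : Pat a θ → Edge g b Pat (some (Sum.inl i)) (.t a θ) .w
  | tA (a : I) (θ : Θ) : Pat a θ → Edge g b Pat none (.t a θ) .w
  | tR (a : I) (θ : Θ) : Pat a θ → Edge g b Pat (some (Sum.inr θ)) (.t a θ) (.y a)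
  | tW (a : I) (θ θ' : Θ) : Pat a θ → θ' ≠ θ → Edge g b Pat (some (Sum.inr θ')) (.t a θ) .W
  | sY (θ : Θ) (i : I) : Edge g b Pat (some (Sum.inl i)) (.s θ) .w
  | sA (θ : Θ) : Edge g b Pat none (.s θ) .w
  | sR (θ : Θ) : Edge g b Pat (some (Sum.inr θ)) (.s θ) .w
  | sW (θ θ' : Θ) : θ' ≠ θ → Edge g b Pat (some (Sum.inr θ')) (.s θ) .W
  | WY (i : I) : Edge g b Pat (some (Sum.inl i)) .W .W
  | WA : Edge g b Pat none .W .W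

/-- Nodes labelled by both `F` and `T`. -/
inductive Tw {I Θ : Type} (Pat : I → Θ → Prop) : Nd I Θ → Prop
  | t (a : I) (θ : Θ) : Pat a θ → Tw Pat (.t a θ)
  | s (θ : Θ) : Tw Pat (.s θ)
  | w : Tw Pat .w

section core

variable {I Θ : Type} (g : Θ → ℕ) (b : Θ → I) (Pat : I → Θ → Prop) (ρ : RelS I Θ → ℕ)

/-- The query. -/
def qry : Set (At ℕ (Nd I Θ)) := fun at' => match at' with
  | .F v => Tw Pat v ∨ v = .x
  | .T v => Tw Pat v ∨ ∃ i, v = .y i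
  | .A _ => False
  | .R k v v' => ∃ r, ρ r = k ∧ Edge g b Pat r v v'

/-- `h` maps the body of the query into `A`. -/
def Body {α : Type} (A : Set (At ℕ α)) (h : Nd I Θ → α) : Prop :=
  (∀ r v v', Edge g b Pat r v v' → At.R (ρ r) (h v) (h v') ∈ A) ∧
  (∀ v, Tw Pat v → At.F (h v) ∈ A ∧ At.T (h v) ∈ A)

/-- Skeletons. -/
structure Skel (D : Set (List I)) : Prop where
  fin : D.Finite
  nil : [] ∈ D
  cl : ∀ w i, w ++ [i] ∈ D → w ∈ D

/-- `D`-shaped cactus is realised in `A` by `G`. -/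
structure RealD {α : Type} (A : Set (At ℕ α)) (D : Set (List I)) (G : List I → Nd I Θ → α) :
    Prop where
  body : ∀ w ∈ D, Body g b Pat ρ A (G w)
  root : At.F (G [] .x) ∈ A
  lab : ∀ w ∈ D, w ≠ [] → At.A (G w .x) ∈ A
  link : ∀ w ∈ D, ∀ i, G w (.y i) = G (w ++ [i]) .x
  leaf : ∀ w ∈ D, ∀ i, w ++ [i] ∉ D → At.T (G w (.y i)) ∈ A

theorem cert_of_real {α : Type} {A : Set (At ℕ α)} {D : Set (List I)} (hD : Skel D)
    {G : List I → Nd I Θ → α} (hG : RealD g b Pat ρ A D G) : covACert A (qry g b Pat ρ) := by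
  intro c
  let S : Set (List I) := {w | w ∈ D ∧ (minModel A c).FS (G w .x)}
  have hS : S.Finite := hD.fin.subset (fun w hw => hw.1)
  have hne : S.Nonempty := ⟨[], hD.nil, Or.inl hG.root⟩
  obtain ⟨w, hw, hmax⟩ := Set.exists_max_image S List.length hS hne
  refine ⟨G w, ?_⟩
  have hB := hG.body w hw.1
  rintro (v | v | v | ⟨k, v, v'⟩) ha
  · rcases ha with ha | rfl
    · exact Or.inl (hB.2 v ha).1
    · exact hw.2
  · rcases ha with ha | ⟨i, rfl⟩
    · exact Or.inl (hB.2 v ha).2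
    · show (minModel A c).TS (G w (.y i))
      by_cases hi : w ++ [i] ∈ D
      · have hA := hG.lab _ hi (by simp)
        rw [hG.link w hw.1 i]
        have hnF : ¬ (minModel A c).FS (G (w ++ [i]) .x) := by
          intro hF
          have := hmax (w ++ [i]) ⟨hi, hF⟩
          simp at this
        simp only [minModel, undecided] at hnF ⊢
        cases hc : c (G (w ++ [i]) .x) <;> simp_all; tauto
      · exact Or.inl (hG.leaf w hw.1 i hi)
  · exact ha.elim
  · obtain ⟨r, rfl, hr⟩ := ha
    exact hB.1 _ _ _ hr

/-- Derivations. -/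
inductive Der {α : Type} (A : Set (At ℕ α)) : α → Prop
  | base (a : α) : At.T a ∈ A → Der A a
  | step (h : Nd I Θ → α) : At.A (h .x) ∈ A → Body g b Pat ρ A h →
      (∀ i, Der A (h (.y i))) → Der A (h .x)

/-- Partial realisation below a node. -/
def SubR {α : Type} (A : Set (At ℕ α)) (a : α) : Prop :=
  ∃ (D : Set (List I)) (G : List I → Nd I Θ → α), D.Finite ∧ (∀ w i, w ++ [i] ∈ D → w ∈ D) ∧
    (∀ w ∈ D, Body g b Pat ρ A (G w)) ∧ (∀ w ∈ D, At.A (G w .x) ∈ A) ∧ G [] .x = a ∧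
    (∀ w ∈ D, ∀ i, G w (.y i) = G (w ++ [i]) .x) ∧
    (∀ w ∈ D, ∀ i, w ++ [i] ∉ D → At.T (G w (.y i)) ∈ A) ∧ ([] ∉ D → At.T a ∈ A)

theorem combine [Finite I] {α : Type} {A : Set (At ℕ α)} (h : Nd I Θ → α)
    (hB : Body g b Pat ρ A h) (hs : ∀ i, SubR g b Pat ρ A (h (.y i))) :
    ∃ (D : Set (List I)) (G : List I → Nd I Θ → α), Skel D ∧ G [] = h ∧
    (∀ w ∈ D, Body g b Pat ρ A (G w)) ∧ (∀ w ∈ D, w ≠ [] → At.A (G w .x) ∈ A) ∧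
    (∀ w ∈ D, ∀ i, G w (.y i) = G (w ++ [i]) .x) ∧
    (∀ w ∈ D, ∀ i, w ++ [i] ∉ D → At.T (G w (.y i)) ∈ A) := by
  choose D G hfin hcl hb hA hr hl hT hn using hs
  let D' : Set (List I) := fun w => match w with
    | [] => True
    | i :: w => w ∈ D i
  let G' : List I → Nd I Θ → α := fun w => match w with
    | [] => h
    | i :: w => G i w
  refine ⟨D', G', ⟨?_, trivial, ?_⟩, rfl, ?_, ?_, ?_, ?_⟩
  · have : D' ⊆ {[]} ∪ ⋃ i, (List.cons i) '' (D i) := by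
      rintro (_ | ⟨i, w⟩) hw
      · simp
      · right
        exact Set.mem_iUnion.2 ⟨i, w, hw, rfl⟩
    refine Set.Finite.subset ?_ this
    exact (Set.finite_singleton _).union (Set.finite_iUnion fun i => (hfin i).image _)
  · rintro (_ | ⟨j, w⟩) i hw
    · trivial
    · exact hcl j w i hw
  · rintro (_ | ⟨j, w⟩) hw
    · exact hB
    · exact hb j w hw
  · rintro (_ | ⟨j, w⟩) hw hne
    · exact absurd rfl hne
    · exact hA j w hw
  · rintro (_ | ⟨j, w⟩) hw i
    · exact (hr i).symm
    · exact hl j w hw i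
  · rintro (_ | ⟨j, w⟩) hw i hi
    · exact hn i hi
    · exact hT j w hw i hi

theorem subR_of_der [Finite I] {α : Type} {A : Set (At ℕ α)} {a : α}
    (h : Der g b Pat ρ A a) : SubR g b Pat ρ A a := by
  induction h with
  | base a ha =>
    exact ⟨∅, fun _ _ => a, Set.finite_empty, by simp, by simp, by simp, rfl, by simp, by simp,
      fun _ => ha⟩
  | step h hA hB _ ih =>
    obtain ⟨D, G, hD, hG, h1, h2, h3, h4⟩ := combine g b Pat ρ h hB ih
    refine ⟨D, G, hD.fin, hD.cl, h1, ?_, by rw [hG], h3, h4, fun h => (h hD.nil).elim⟩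
    intro w hw
    by_cases hne : w = []
    · subst hne; rw [hG]; exact hA
    · exact h2 w hw hne

theorem real_of_cert [Finite I] {α : Type} {A : Set (At ℕ α)}
    (hc : covACert A (qry g b Pat ρ)) :
    ∃ D, Skel D ∧ ∃ G, RealD g b Pat ρ A D G := by
  obtain ⟨h, hh⟩ := hc (fun a => !decide (Der g b Pat ρ A a))
  have hB : Body g b Pat ρ A h := by
    constructor
    · intro r v v' hr
      exact hh (.R (ρ r) v v') ⟨r, rfl, hr⟩
    · intro v hv
      have h1 := hh (.F v) (Or.inl hv)
      have h2 := hh (.T v) (Or.inl hv)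
      simp only [Interp.satAt, At.map, minModel, undecided] at h1 h2
      rcases h1 with h1 | ⟨h1, h1'⟩ <;> rcases h2 with h2 | ⟨h2, h2'⟩ <;> simp_all
  have hy : ∀ i, Der g b Pat ρ A (h (.y i)) := by
    intro i
    have h2 := hh (.T (.y i)) (Or.inr ⟨i, rfl⟩)
    simp only [Interp.satAt, At.map, minModel] at h2
    rcases h2 with h2 | ⟨h2, h2'⟩
    · exact .base _ h2
    · simpa using h2'
  have hx : At.F (h .x) ∈ A := by
    have h1 := hh (.F .x) (Or.inr rfl)
    simp only [Interp.satAt, At.map, minModel] at h1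
    rcases h1 with h1 | ⟨h1, h1'⟩
    · exact h1
    · have := Der.step (g := g) (b := b) (Pat := Pat) (ρ := ρ) h h1.1 hB hy
      simp [this] at h1'
  obtain ⟨D, G, hD, hG, h1, h2, h3, h4⟩ :=
    combine g b Pat ρ h hB (fun i => subR_of_der g b Pat ρ (hy i))
  exact ⟨D, hD, G, h1, by rw [hG]; exact hx, h2, h3, h4⟩

/-- Erroneous skeletons. -/
def Err (D : Set (List I)) : Prop :=
  ∃ (w : List I) (a : I) (θ : Θ) (l : List I), Pat a θ ∧ l.length = g θ ∧
    w ++ [a] ++ l ++ [b θ] ∈ D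

theorem Skel.pre {D : Set (List I)} (hD : Skel D) : ∀ (l w : List I), w ++ l ∈ D → w ∈ D := by
  intro l
  induction l using List.reverseRecOn with
  | nil => intro w h; simpa using h
  | append_singleton l i ih =>
    intro w h
    rw [← List.append_assoc] at h
    exact ih w (hD.cl _ _ h)

theorem real_of_err [Nonempty I] {α : Type} {A : Set (At ℕ α)} {D : Set (List I)} (hD : Skel D)
    {G : List I → Nd I Θ → α} (hG : RealD g b Pat ρ A D G) (he : Err g b Pat D) :
    ∃ G', RealD g b Pat ρ A {[]} G' := by
  obtain ⟨w, a, θ, l, hP, hl, hm⟩ := he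
  have hwal := hD.cl _ _ hm
  have hwa := hD.pre _ _ hwal
  have hw := hD.cl _ _ hwa
  have hBw := hG.body w hw
  let i0 : I := Classical.arbitrary I
  -- path nodes
  let L : List I := l ++ [b θ] ++ [i0]
  let pth : ℕ → α := fun k => G (w ++ [a] ++ L.take k) .x
  have hLk : ∀ k, k ≤ g θ + 1 → w ++ [a] ++ L.take k ∈ D := by
    intro k hk
    have : L.take k = (l ++ [b θ]).take k := by
      simp only [L]
      rw [List.take_append_of_le_length]
      simp [hl, hk]
    rw [this]
    apply hD.pre ((l ++ [b θ]).drop k)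
    rw [List.append_assoc, List.take_append_drop]
    simpa using hm
  have hLlen : L.length = g θ + 2 := by simp [L, hl]
  have hstep : ∀ k (hk : k ≤ g θ + 1), pth (k+1) = G (w ++ [a] ++ L.take k) (.y (L[k]'(by omega))) := by
    intro k hk
    rw [hG.link _ (hLk k hk)]
    simp only [pth]
    rw [← List.take_concat_get' L k (by omega)]
    simp
  let h : Nd I Θ → α := fun v => match v with
    | .x => G w (.t a θ)
    | .y _ => G w .w
    | .u θ' k => if θ' = θ then pth k else G w .W
    | .t _ θ' => G w (.s θ')
    | .s θ' => G w (.s θ')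
    | .w => G w .w
    | .W => G w .W
  have hB : Body g b Pat ρ A h := by
    constructor
    · intro r v v' hr
      cases hr with
      | xY i => exact hBw.1 _ _ _ (.tY a θ i hP)
      | xA i => exact hBw.1 _ _ _ (.tA a θ hP)
      | xR θ' =>
        by_cases hθ : θ' = θ
        · subst hθ
          have := hBw.1 _ _ _ (.tR a θ' hP)
          rw [hG.link _ hw] at this
          simpa [h, pth] using this
        · simpa [h, hθ] using hBw.1 _ _ _ (.tW a θ θ' hP hθ)
      | uA θ' k hk hk' =>
        by_cases hθ : θ' = θ
        · subst hθ
          have := (hG.body _ (hLk k hk)).1 _ _ _ (.xA (L[k]'(by omega)))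
          simp only [h, if_true]
          rw [hstep k hk]
          exact this
        · simpa [h, hθ] using hBw.1 _ _ _ .WA
      | uY θ' =>
        by_cases hθ : θ' = θ
        · subst hθ
          have := (hG.body _ (hLk (g θ') (by omega))).1 _ _ _ (.xY (L[g θ']'(by omega)))
          simp only [h, if_true]
          rw [hstep (g θ') (by omega)]
          have hb : L[g θ']'(by omega) = b θ' := by
            simp [L, ← hl]
          rw [hb] at this ⊢
          exact this
        · simpa [h, hθ] using hBw.1 _ _ _ (.WY _)
      | tY a' θ' i hp => exact hBw.1 _ _ _ (.sY _ _)
      | tA a' θ' hp => exact hBw.1 _ _ _ (.sA _)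
      | tR a' θ' hp => exact hBw.1 _ _ _ (.sR _)
      | tW a' θ' θ'' hp hne => exact hBw.1 _ _ _ (.sW _ _ hne)
      | sY θ' i => exact hBw.1 _ _ _ (.sY _ _)
      | sA θ' => exact hBw.1 _ _ _ (.sA _)
      | sR θ' => exact hBw.1 _ _ _ (.sR _)
      | sW θ' θ'' hne => exact hBw.1 _ _ _ (.sW _ _ hne)
      | WY i => exact hBw.1 _ _ _ (.WY i)
      | WA => exact hBw.1 _ _ _ .WA
    · intro v hv
      cases hv with
      | t a' θ' hp => exact hBw.2 _ (.s _)
      | s θ' => exact hBw.2 _ (.s _)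
      | w => exact hBw.2 _ .w
  refine ⟨fun l' => match l' with
    | [] => h
    | _ :: _ => fun _ => G w .w, ?_, ?_, ?_, ?_, ?_⟩
  · rintro _ rfl; exact hB
  · exact (hBw.2 _ (.t a θ hP)).1
  · rintro _ rfl hne; exact absurd rfl hne
  · rintro _ rfl i; rfl
  · rintro _ rfl i _; exact (hBw.2 _ .w).2

/-- Nodes of a cactus. -/
inductive CN (I Θ : Type) : Type
  | word : List I → CN I Θ
  | inn : List I → Nd I Θ → CN I Θ

/-- The copy of a query node in the segment `w`. -/
def nd (w : List I) : Nd I Θ → CN I Θ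
  | .x => .word w
  | .y i => .word (w ++ [i])
  | v => .inn w v

/-- The cactus with skeleton `D`. -/
def cac (D : Set (List I)) : Set (At ℕ (CN I Θ)) := fun at' => match at' with
  | .F n => n = .word [] ∨ ∃ w ∈ D, ∃ v, Tw Pat v ∧ n = nd w v
  | .T n => (∃ w ∈ D, ∃ i, w ++ [i] ∉ D ∧ n = .word (w ++ [i])) ∨
      ∃ w ∈ D, ∃ v, Tw Pat v ∧ n = nd w v
  | .A n => ∃ w ∈ D, w ≠ [] ∧ n = .word w
  | .R k n n' => ∃ r, ρ r = k ∧ ∃ w ∈ D, ∃ v v', Edge g b Pat r v v' ∧ n = nd w v ∧ n' = nd w v'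

theorem real_cac (D : Set (List I)) : RealD g b Pat ρ (cac g b Pat ρ D) D (nd (Θ := Θ)) where
  body w hw := ⟨fun r v v' hr => ⟨r, rfl, w, hw, v, v', hr, rfl, rfl⟩,
    fun v hv => ⟨Or.inr ⟨w, hw, v, hv, rfl⟩, Or.inr ⟨w, hw, v, hv, rfl⟩⟩⟩
  root := Or.inl rfl
  lab w hw hne := ⟨w, hw, hne, rfl⟩
  link _ _ _ := rfl
  leaf w hw i hi := Or.inl ⟨w, hw, i, hi, rfl⟩

variable {g b Pat ρ}

theorem word_edge (hρ : Function.Injective ρ) {D : Set (List I)} {r : RelS I Θ} {v : List I}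
    {n : CN I Θ} (h : At.R (ρ r) (CN.word v) n ∈ cac g b Pat ρ D) (hr : ∀ θ, r ≠ some (Sum.inr θ)) :
    v ∈ D ∧ ∃ i, n = CN.word (v ++ [i]) ∧ (∀ j, r = some (Sum.inl j) → i = j) := by
  obtain ⟨r', hr', w, hw, p, p', he, h1, h2⟩ := h
  obtain rfl := hρ hr'
  cases he <;> simp only [nd, CN.word.injEq, reduceCtorEq] at h1 h2
  case xY i => subst h1; exact ⟨hw, i, h2, by simp⟩
  case xA i => subst h1; exact ⟨hw, i, h2, by simp⟩
  case xR θ => exact absurd rfl (hr θ)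

theorem inn_edge (hρ : Function.Injective ρ) {D : Set (List I)} {r : RelS I Θ} {w : List I}
    {v : Nd I Θ} {n : CN I Θ} (h : At.R (ρ r) (CN.inn w v) n ∈ cac g b Pat ρ D) :
    ∃ v', Edge g b Pat r v v' ∧ n = nd w v' := by
  obtain ⟨r', hr', w', hw, p, p', he, h1, h2⟩ := h
  obtain rfl := hρ hr'
  cases p <;> simp only [nd, CN.inn.injEq, reduceCtorEq] at h1 <;>
    (obtain ⟨rfl, rfl⟩ := h1; exact ⟨p', he, h2⟩)

theorem no_edge_w {r : RelS I Θ} {v : Nd I Θ} (h : Edge g b Pat r .w v) : False := by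
  cases h

theorem rigid [Nonempty I] (hρ : Function.Injective ρ) {D D' : Set (List I)} (hD : Skel D) (hD' : Skel D')
    (hne : ¬ Err g b Pat D) {G : List I → Nd I Θ → CN I Θ}
    (hG : RealD g b Pat ρ (cac g b Pat ρ D) D' G) : D' = D := by
  have hB0 := hG.body [] hD'.nil
  have i0 : I := Classical.arbitrary I
  have hroot : G [] .x = .word [] := by
    rcases hG.root with h | ⟨w, hw, v, hv, h⟩
    · exact h
    exfalso
    cases hv with
    | w =>
      have := hB0.1 _ _ _ (.xY i0)
      rw [h] at this
      obtain ⟨v', he, _⟩ := inn_edge hρ this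
      cases he
    | s θ =>
      have := hB0.1 _ _ _ (.xR θ)
      rw [h] at this
      obtain ⟨v', he, h2⟩ := inn_edge hρ this
      cases he with
      | sW _ _ hne' => exact hne' rfl
      | sR =>
        by_cases hg : g θ = 0
        · have h3 := hB0.1 _ _ _ (.uY θ)
          rw [hg, h2] at h3
          obtain ⟨v', he, _⟩ := inn_edge hρ h3
          exact no_edge_w he
        · have h3 := hB0.1 _ _ _ (.uA θ 0 (by omega) (by omega))
          rw [h2] at h3
          obtain ⟨v', he, _⟩ := inn_edge hρ h3
          exact no_edge_w he
    | t a θ hP =>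
      have := hB0.1 _ _ _ (.xR θ)
      rw [h] at this
      obtain ⟨v', he, h2⟩ := inn_edge hρ this
      cases he with
      | tW _ _ _ _ hne' => exact hne' rfl
      | tR =>
        have key : ∀ k, k ≤ g θ → ∃ l : List I, l.length = k ∧
            G [] (.u θ k) = .word (w ++ [a] ++ l) := by
          intro k
          induction k with
          | zero => intro _; exact ⟨[], rfl, by simpa [nd] using h2⟩
          | succ k ih =>
            intro hk
            obtain ⟨l, hl, hl'⟩ := ih (by omega)
            have h3 := hB0.1 _ _ _ (.uA θ k (by omega) (by omega))
            rw [hl'] at h3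
            obtain ⟨_, i, h4, _⟩ := word_edge hρ h3 (by simp)
            exact ⟨l ++ [i], by simp [hl], by rw [h4]; simp⟩
        obtain ⟨l, hl, hl'⟩ := key _ le_rfl
        have h3 := hB0.1 _ _ _ (.uY θ)
        rw [hl'] at h3
        obtain ⟨_, i, h4, h5⟩ := word_edge hρ h3 (by simp)
        obtain rfl := h5 _ rfl
        have h6 := hB0.1 _ _ _ (.uA θ (g θ + 1) (by omega) (by omega))
        rw [h4] at h6
        obtain ⟨h7, _⟩ := word_edge hρ h6 (by simp)
        exact hne ⟨w, a, θ, l, hP, hl, h7⟩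
  have key : ∀ w, w ∈ D' → w ∈ D ∧ G w .x = .word w ∧ ∀ i, G w (.y i) = .word (w ++ [i]) := by
    have aux : ∀ w, w ∈ D' → G w .x = .word w →
        w ∈ D ∧ G w .x = .word w ∧ ∀ i, G w (.y i) = .word (w ++ [i]) := by
      intro w hw hx
      have h : ∀ i, w ∈ D ∧ G w (.y i) = .word (w ++ [i]) := by
        intro i
        have h3 := (hG.body w hw).1 _ _ _ (.xY i)
        rw [hx] at h3
        obtain ⟨h4, j, h5, h6⟩ := word_edge hρ h3 (by simp)
        rw [h6 _ rfl] at h5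
        exact ⟨h4, h5⟩
      exact ⟨(h i0).1, hx, fun i => (h i).2⟩
    intro w
    induction w using List.reverseRecOn with
    | nil => intro hw; exact aux _ hw hroot
    | append_singleton w i ih =>
      intro hw
      have hw' := hD'.cl _ _ hw
      apply aux _ hw
      rw [← hG.link w hw' i]
      exact (ih hw').2.2 i
  apply Set.Subset.antisymm (fun w hw => (key w hw).1)
  intro w
  induction w using List.reverseRecOn with
  | nil => intro _; exact hD'.nil
  | append_singleton w i ih =>
    intro hw
    have hw' := ih (hD.cl _ _ hw)
    by_contra hn
    have hT := hG.leaf w hw' i hn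
    rw [(key w hw').2.2 i] at hT
    rcases hT with ⟨v, hv, j, hj, he⟩ | ⟨v, hv, p, hp, he⟩
    · rw [CN.word.injEq] at he
      exact hj (he ▸ hw)
    · cases hp <;> simp [nd] at he

end core
section fo

theorem At.map_injective {σ α β : Type} {f : α → β} (hf : Function.Injective f) :
    Function.Injective (At.map (σ := σ) f) := by
  rintro (a | a | a | ⟨r, a, a'⟩) (c | c | c | ⟨r', c, c'⟩) h <;> simp [At.map] at h ⊢
  · exact hf h
  · exact hf h
  · exact hf h
  · exact ⟨h.1, hf h.2.1, hf h.2.2⟩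

theorem indSet_finite {σ α : Type} {B : Set (At σ α)} (hB : B.Finite) : (indSet B).Finite := by
  have : indSet B = ⋃ a ∈ B, At.vars a := by
    ext x; simp [indSet]
  rw [this]
  refine hB.biUnion fun a _ => ?_
  cases a <;> simp [At.vars]

theorem exists_lift {σ α : Type} {B : Set (At σ α)} {a : At σ α} (ha : a ∈ B) :
    ∃ a' : At σ (indSet B), At.map Subtype.val a' = a := by
  rcases a with a | a | a | ⟨r, a, c⟩
  · exact ⟨.F ⟨a, _, ha, by simp [At.vars]⟩, rfl⟩
  · exact ⟨.T ⟨a, _, ha, by simp [At.vars]⟩, rfl⟩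
  · exact ⟨.A ⟨a, _, ha, by simp [At.vars]⟩, rfl⟩
  · exact ⟨.R r ⟨a, _, ha, by simp [At.vars]⟩ ⟨c, _, ha, by simp [At.vars]⟩, rfl⟩

/-- The symbol `F`. -/
def rF : (Lsig ℕ).Relations 1 := URel.uf

/-- The symbol `T`. -/
def rT : (Lsig ℕ).Relations 1 := URel.ut

/-- The symbol `A`. -/
def rA : (Lsig ℕ).Relations 1 := URel.ua

/-- The binary symbols. -/
def rR (r : ℕ) : (Lsig ℕ).Relations 2 := r

/-- The first-order formula of an atom. -/
def atForm {S : Type} : At ℕ S → (Lsig ℕ).Formula (Empty ⊕ S)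
  | .F a => Language.Relations.formula₁ (L := Lsig ℕ) rF
      (Language.Term.var (Sum.inr a))
  | .T a => Language.Relations.formula₁ (L := Lsig ℕ) rT
      (Language.Term.var (Sum.inr a))
  | .A a => Language.Relations.formula₁ (L := Lsig ℕ) rA
      (Language.Term.var (Sum.inr a))
  | .R r a c => Language.Relations.formula₂ (L := Lsig ℕ) (rR r)
      (Language.Term.var (Sum.inr a)) (Language.Term.var (Sum.inr c))

theorem realize_atForm {S δ : Type} (J : Interp ℕ δ) (h : S → δ) (v : Empty → δ) (a : At ℕ S) :
    @Language.Formula.Realize (Lsig ℕ) δ (interpStructure J) _ (atForm a) (Sum.elim v h) ↔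
      J.satAt (At.map h a) := by
  letI := interpStructure J
  rcases a with a | a | a | ⟨r, a, c⟩
  · simp only [atForm]; rw [Language.Formula.realize_rel₁]; exact Iff.rfl
  · simp only [atForm]; rw [Language.Formula.realize_rel₁]; exact Iff.rfl
  · simp only [atForm]; rw [Language.Formula.realize_rel₁]; exact Iff.rfl
  · simp only [atForm]; rw [Language.Formula.realize_rel₂]; exact Iff.rfl

theorem cq_fo {N : Type} (B : Set (At ℕ N)) (hB : B.Finite) (hne : B.Nonempty) :
    ∃ Φ : (Lsig ℕ).Sentence, ∀ (α : Type) (A : Set (At ℕ α)),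
      ((toInterp A).satCQ B ↔ foHolds A Φ) := by
  haveI : Finite (indSet B) := indSet_finite hB
  let K := {a' : At ℕ (indSet B) // At.map Subtype.val a' ∈ B}
  haveI : Finite K := by
    have : ((At.map Subtype.val) ⁻¹' B : Set (At ℕ (indSet B))).Finite :=
      hB.preimage (At.map_injective Subtype.val_injective).injOn
    exact this
  refine ⟨Language.Formula.iExs (indSet B) (Language.Formula.iInf (fun k : K => atForm k.1)), ?_⟩
  intro α A
  letI := interpStructure (restrictI A)
  unfold foHolds Language.Sentence.Realize
  rw [Language.Formula.realize_iExs]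
  simp only [Language.Formula.realize_iInf]
  constructor
  · rintro ⟨h, hh⟩
    have hin : ∀ x : indSet B, h x.1 ∈ indSet A := by
      rintro ⟨x, a, ha, hx⟩
      refine ⟨At.map h a, ?_, ?_⟩
      · have := hh a ha
        cases a <;> exact this
      · rcases a with a | a | a | ⟨r, a, c⟩ <;> simp [At.vars, At.map] at hx ⊢
        · rw [hx]
        · rw [hx]
        · rw [hx]
        · rcases hx with rfl | rfl <;> simp
    refine ⟨fun x => ⟨h x.1, hin x⟩, ?_⟩
    rintro ⟨a, ha⟩
    rw [realize_atForm]
    have := hh _ ha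
    cases a <;> exact this
  · rintro ⟨h, hh⟩
    obtain ⟨a0, ha0⟩ := hne
    obtain ⟨x0, hx0⟩ : ∃ x, x ∈ indSet B := by
      rcases a0 with a | a | a | ⟨r, a, c⟩ <;> exact ⟨a, _, ha0, by simp [At.vars]⟩
    refine ⟨fun x => if hx : x ∈ indSet B then (h ⟨x, hx⟩).1 else (h ⟨x0, hx0⟩).1, ?_⟩
    intro a ha
    obtain ⟨a', rfl⟩ := exists_lift ha
    have := hh ⟨a', ha⟩
    rw [realize_atForm] at this
    rcases a' with a | a | a | ⟨r, a, c⟩ <;>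
      simpa [At.map, Interp.satAt, toInterp, restrictI] using this

theorem ucq_fo {ι N : Type} [Finite ι] (B : ι → Set (At ℕ N)) (hB : ∀ i, (B i).Finite)
    (hne : ∀ i, (B i).Nonempty) :
    ∃ Φ : (Lsig ℕ).Sentence, ∀ (α : Type) (A : Set (At ℕ α)),
      ((∃ i, (toInterp A).satCQ (B i)) ↔ foHolds A Φ) := by
  choose Φ hΦ using fun i => cq_fo (B i) (hB i) (hne i)
  refine ⟨Language.Formula.iSup Φ, ?_⟩
  intro α A
  letI := interpStructure (restrictI A)
  unfold foHolds Language.Sentence.Realize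
  rw [Language.Formula.realize_iSup]
  exact exists_congr fun i => hΦ i α A

end fo

section prod

/-- Product of ABoxes. -/
def prodA {σ α β : Type} (A : Set (At σ α)) (B : Set (At σ β)) : Set (At σ (α × β)) :=
  {a | At.map Prod.fst a ∈ A ∧ At.map Prod.snd a ∈ B}

theorem prodA_finite {σ α β : Type} {A : Set (At σ α)} {B : Set (At σ β)} (hA : A.Finite)
    (hB : B.Finite) : (prodA A B).Finite := by
  have : Set.InjOn (fun a : At σ (α × β) => (At.map Prod.fst a, At.map Prod.snd a)) Set.univ := by
    rintro (a | a | a | ⟨r, a, a'⟩) _ (c | c | c | ⟨r', c, c'⟩) _ h <;>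
      simp [At.map, Prod.ext_iff] at h ⊢ <;> tauto
  exact ((hA.prod hB).preimage (this.mono (Set.subset_univ _))).subset (fun a ha => ⟨ha.1, ha.2⟩)

/-- Disjunction-free formulas. -/
def PE.dfree {σ : Type} : PE σ → Prop
  | .conj φ ψ => φ.dfree ∧ ψ.dfree
  | .disj _ _ => False
  | .ex _ φ => φ.dfree
  | _ => True

/-- Disjunctive normal form. -/
def PE.dnf {σ : Type} : PE σ → List (PE σ)
  | .conj φ ψ => (List.product φ.dnf ψ.dnf).map (fun p => .conj p.1 p.2)
  | .disj φ ψ => φ.dnf ++ ψ.dnf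
  | .ex n φ => φ.dnf.map (.ex n)
  | φ => [φ]

theorem PE.size_pos {σ : Type} (φ : PE σ) : 1 ≤ φ.size := by
  induction φ <;> simp [PE.size] <;> omega

theorem PE.dnf_length {σ : Type} (φ : PE σ) : φ.dnf.length ≤ 2 ^ φ.size := by
  induction φ with
  | atF => simp [PE.dnf, PE.size]
  | atT => simp [PE.dnf, PE.size]
  | atA => simp [PE.dnf, PE.size]
  | atR => simp [PE.dnf, PE.size]
  | conj φ ψ h1 h2 =>
    simp only [PE.dnf, PE.size, List.length_map, pow_add]
    exact (List.length_product _ _).le.trans (Nat.mul_le_mul h1 h2)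
  | disj φ ψ h1 h2 =>
    simp only [PE.dnf, PE.size, List.length_append, pow_add]
    have h3 : 2 ^ 1 ≤ 2 ^ φ.size := Nat.pow_le_pow_right (by norm_num) φ.size_pos
    have h4 : 2 ^ 1 ≤ 2 ^ ψ.size := Nat.pow_le_pow_right (by norm_num) ψ.size_pos
    nlinarith
  | ex n φ h => simpa [PE.dnf, PE.size] using h

theorem PE.dnf_dfree {σ : Type} (φ : PE σ) : ∀ ψ ∈ φ.dnf, ψ.dfree := by
  induction φ with
  | conj φ ψ h1 h2 =>
    intro χ hχ
    simp only [PE.dnf, List.mem_map] at hχ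
    obtain ⟨⟨p, p'⟩, hp, rfl⟩ := hχ
    rw [List.pair_mem_product] at hp
    exact ⟨h1 _ hp.1, h2 _ hp.2⟩
  | disj φ ψ h1 h2 =>
    intro χ hχ
    simp only [PE.dnf, List.mem_append] at hχ
    exact hχ.elim (h1 _) (h2 _)
  | ex n φ h =>
    intro χ hχ
    simp only [PE.dnf, List.mem_map] at hχ
    obtain ⟨p, hp, rfl⟩ := hχ
    exact h p hp
  | _ => intro χ hχ; simp only [PE.dnf, List.mem_singleton] at hχ; subst hχ; trivial

theorem PE.realize_dnf {σ α : Type} (A : Set (At σ α)) (φ : PE σ) : ∀ ν : ℕ → α,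
    φ.Realize A ν ↔ ∃ ψ ∈ φ.dnf, ψ.Realize A ν := by
  induction φ with
  | conj φ ψ h1 h2 =>
    intro ν
    simp only [PE.dnf, List.mem_map, PE.Realize, h1, h2]
    constructor
    · rintro ⟨⟨p, hp, hp'⟩, ⟨r, hr, hr'⟩⟩
      exact ⟨_, ⟨(p, r), List.pair_mem_product.2 ⟨hp, hr⟩, rfl⟩, hp', hr'⟩
    · rintro ⟨_, ⟨⟨p, r⟩, hpr, rfl⟩, hp', hr'⟩
      rw [List.pair_mem_product] at hpr
      exact ⟨⟨p, hpr.1, hp'⟩, ⟨r, hpr.2, hr'⟩⟩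
  | disj φ ψ h1 h2 =>
    intro ν
    simp only [PE.dnf, List.mem_append, PE.Realize, h1, h2]
    constructor
    · rintro (⟨p, hp, hp'⟩ | ⟨p, hp, hp'⟩)
      · exact ⟨p, Or.inl hp, hp'⟩
      · exact ⟨p, Or.inr hp, hp'⟩
    · rintro ⟨p, hp | hp, hp'⟩
      · exact Or.inl ⟨p, hp, hp'⟩
      · exact Or.inr ⟨p, hp, hp'⟩
  | ex n φ h =>
    intro ν
    simp only [PE.dnf, List.mem_map, PE.Realize, h]
    constructor
    · rintro ⟨a, ha, p, hp, hp'⟩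
      exact ⟨_, ⟨p, hp, rfl⟩, a, ha, hp'⟩
    · rintro ⟨_, ⟨p, hp, rfl⟩, a, ha, hp'⟩
      exact ⟨a, ha, p, hp, hp'⟩
  | _ => intro ν; simp [PE.dnf]

theorem PE.ind_nonempty {σ α : Type} {A : Set (At σ α)} (φ : PE σ) : ∀ ν : ℕ → α,
    φ.Realize A ν → (indSet A).Nonempty := by
  induction φ with
  | atF n => exact fun ν h => ⟨ν n, _, h, by simp [At.vars]⟩
  | atT n => exact fun ν h => ⟨ν n, _, h, by simp [At.vars]⟩
  | atA n => exact fun ν h => ⟨ν n, _, h, by simp [At.vars]⟩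
  | atR r n m => exact fun ν h => ⟨ν n, _, h, by simp [At.vars]⟩
  | conj φ ψ h1 h2 => exact fun ν h => h1 ν h.1
  | disj φ ψ h1 h2 => exact fun ν h => h.elim (h1 ν) (h2 ν)
  | ex n φ h => exact fun ν ⟨a, ha, _⟩ => ⟨a, ha⟩

theorem PE.ind_or {σ α : Type} {A : Set (At σ α)} (φ : PE σ) : ∀ (ν : ℕ → α) (n : ℕ),
    φ.Realize A ν → ν n ∈ indSet A ∨ ∀ a, φ.Realize A (Function.update ν n a) := by
  induction φ with
  | atF m =>
    intro ν n h
    by_cases hm : m = n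
    · subst hm; exact Or.inl ⟨_, h, by simp [At.vars]⟩
    · right; intro a; simpa [PE.Realize, Function.update_of_ne hm] using h
  | atT m =>
    intro ν n h
    by_cases hm : m = n
    · subst hm; exact Or.inl ⟨_, h, by simp [At.vars]⟩
    · right; intro a; simpa [PE.Realize, Function.update_of_ne hm] using h
  | atA m =>
    intro ν n h
    by_cases hm : m = n
    · subst hm; exact Or.inl ⟨_, h, by simp [At.vars]⟩
    · right; intro a; simpa [PE.Realize, Function.update_of_ne hm] using h
  | atR r m m' =>
    intro ν n h
    by_cases hm : m = n
    · subst hm; exact Or.inl ⟨_, h, by simp [At.vars]⟩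
    · by_cases hm' : m' = n
      · subst hm'; exact Or.inl ⟨_, h, by simp [At.vars]⟩
      · right; intro a
        simpa [PE.Realize, Function.update_of_ne hm, Function.update_of_ne hm'] using h
  | conj φ ψ h1 h2 =>
    intro ν n h
    rcases h1 ν n h.1 with h3 | h3
    · exact Or.inl h3
    · rcases h2 ν n h.2 with h4 | h4
      · exact Or.inl h4
      · exact Or.inr fun a => ⟨h3 a, h4 a⟩
  | disj φ ψ h1 h2 =>
    intro ν n h
    rcases h with h | h
    · exact (h1 ν n h).imp_right fun h3 a => Or.inl (h3 a)
    · exact (h2 ν n h).imp_right fun h3 a => Or.inr (h3 a)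
  | ex m φ ih =>
    rintro ν n ⟨a0, ha0, h⟩
    by_cases hm : n = m
    · subst hm
      right; intro a
      exact ⟨a0, ha0, by simpa using h⟩
    · rcases ih _ n h with h3 | h3
      · left; simpa [Function.update_of_ne hm] using h3
      · right; intro a
        refine ⟨a0, ha0, ?_⟩
        rw [Function.update_comm hm]
        exact h3 a

theorem PE.realize_prod {σ α β : Type} {A : Set (At σ α)} {B : Set (At σ β)} (φ : PE σ) :
    ∀ (ν : ℕ → α) (μ : ℕ → β), φ.dfree → φ.Realize A ν → φ.Realize B μ →
      φ.Realize (prodA A B) (fun k => (ν k, μ k)) := by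
  induction φ with
  | conj φ ψ h1 h2 => exact fun ν μ hd hA hB => ⟨h1 ν μ hd.1 hA.1 hB.1, h2 ν μ hd.2 hA.2 hB.2⟩
  | disj φ ψ h1 h2 => exact fun ν μ hd => hd.elim
  | ex n φ ih =>
    rintro ν μ hd ⟨a, ha, hA⟩ ⟨c, hc, hB⟩
    have h := ih _ _ hd hA hB
    have he : (fun k => (Function.update ν n a k, Function.update μ n c k)) =
        Function.update (fun k => (ν k, μ k)) n (a, c) := by
      funext k
      by_cases hk : k = n
      · subst hk; simp
      · simp [Function.update_of_ne hk]
    rw [he] at h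
    rcases PE.ind_or φ _ n h with h3 | h3
    · exact ⟨(a, c), by simpa using h3, h⟩
    · obtain ⟨e, he'⟩ := PE.ind_nonempty φ _ h
      exact ⟨e, he', by simpa using h3 e⟩
  | _ => exact fun ν μ _ hA hB => ⟨hA, hB⟩

end prod

section main

variable {I Θ : Type} (g : Θ → ℕ) (b : Θ → I) (Pat : I → Θ → Prop) (ρ : RelS I Θ → ℕ)

theorem hom_of_real {α : Type} {A : Set (At ℕ α)} {D : Set (List I)} (hD : Skel D) :
    (∃ G, RealD g b Pat ρ A D G) ↔ (toInterp A).satCQ (cac g b Pat ρ D) := by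
  constructor
  · rintro ⟨G, hG⟩
    let Ψ : CN I Θ → α := fun n => match n with
      | .word w => G w .x
      | .inn w v => G w v
    have hΨ : ∀ w ∈ D, ∀ v, Ψ (nd w v) = G w v := by
      intro w hw v
      cases v <;> simp only [nd, Ψ]
      exact (hG.link w hw _).symm
    refine ⟨Ψ, ?_⟩
    rintro (n | n | n | ⟨k, n, n'⟩) ha
    · rcases ha with rfl | ⟨w, hw, v, hv, rfl⟩
      · exact hG.root
      · simp only [At.map, hΨ w hw]; exact ((hG.body w hw).2 v hv).1
    · rcases ha with ⟨w, hw, i, hi, rfl⟩ | ⟨w, hw, v, hv, rfl⟩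
      · have := hG.leaf w hw i hi
        rw [hG.link w hw i] at this
        exact this
      · simp only [At.map, hΨ w hw]; exact ((hG.body w hw).2 v hv).2
    · obtain ⟨w, hw, hne, rfl⟩ := ha
      exact hG.lab w hw hne
    · obtain ⟨r, rfl, w, hw, v, v', he, rfl, rfl⟩ := ha
      simp only [At.map, hΨ w hw]; exact (hG.body w hw).1 _ _ _ he
  · rintro ⟨Ψ, hΨ⟩
    have R := real_cac g b Pat ρ D
    refine ⟨fun w v => Ψ (nd w v), ?_, ?_, ?_, ?_, ?_⟩
    · intro w hw
      exact ⟨fun r v v' he => hΨ _ ((R.body w hw).1 r v v' he),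
        fun v hv => ⟨hΨ _ ((R.body w hw).2 v hv).1, hΨ _ ((R.body w hw).2 v hv).2⟩⟩
    · exact hΨ _ R.root
    · exact fun w hw hne => hΨ _ (R.lab w hw hne)
    · intro w hw i; rfl
    · exact fun w hw i hi => hΨ _ (R.leaf w hw i hi)

theorem RealD.map {α β : Type} {A : Set (At ℕ α)} {B : Set (At ℕ β)} {D : Set (List I)}
    {G : List I → Nd I Θ → α} (hG : RealD g b Pat ρ A D G) (f : α → β)
    (hf : ∀ a ∈ A, At.map f a ∈ B) : RealD g b Pat ρ B D (fun w v => f (G w v)) where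
  body w hw := ⟨fun r v v' he => hf _ ((hG.body w hw).1 r v v' he),
        fun v hv => ⟨hf _ ((hG.body w hw).2 v hv).1, hf _ ((hG.body w hw).2 v hv).2⟩⟩
  root := hf _ hG.root
  lab w hw hne := hf _ (hG.lab w hw hne)
  link w hw i := congrArg f (hG.link w hw i)
  leaf w hw i hi := hf _ (hG.leaf w hw i hi)

/-- Two error-free cactuses whose product is a positive instance coincide. -/
theorem eq_of_prod [Finite I] [Nonempty I] (hρ : Function.Injective ρ) {D D' : Set (List I)} (hD : Skel D)
    (hD' : Skel D') (he : ¬ Err g b Pat D) (he' : ¬ Err g b Pat D')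
    (hc : covACert (prodA (cac g b Pat ρ D) (cac g b Pat ρ D')) (qry g b Pat ρ)) : D = D' := by
  obtain ⟨E, hE, G, hG⟩ := real_of_cert g b Pat ρ hc
  have h1 := rigid hρ hD hE he (hG.map g b Pat ρ Prod.fst (fun a ha => ha.1))
  have h2 := rigid hρ hD' hE he' (hG.map g b Pat ρ Prod.snd (fun a ha => ha.2))
  rw [← h1, ← h2]

theorem err_nil : ¬ Err g b Pat {([] : List I)} := by
  rintro ⟨w, a, θ, l, _, _, h⟩
  simp at h

theorem cert_iff [Finite I] [Nonempty I] {α : Type} {A : Set (At ℕ α)} :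
    covACert A (qry g b Pat ρ) ↔ ∃ D, (Skel D ∧ ¬ Err g b Pat D) ∧
      (toInterp A).satCQ (cac g b Pat ρ D) := by
  constructor
  · intro h
    obtain ⟨D, hD, G, hG⟩ := real_of_cert g b Pat ρ h
    by_cases he : Err g b Pat D
    · refine ⟨{[]}, ⟨⟨Set.finite_singleton _, rfl, ?_⟩, err_nil g b Pat⟩, ?_⟩
      · intro w i h; simp at h
      · rw [← hom_of_real]
        · exact real_of_err g b Pat ρ hD hG he
        · exact ⟨Set.finite_singleton _, rfl, by intro w i h; simp at h⟩
    · exact ⟨D, ⟨hD, he⟩, (hom_of_real g b Pat ρ hD).1 ⟨G, hG⟩⟩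
  · rintro ⟨D, ⟨hD, _⟩, h⟩
    obtain ⟨G, hG⟩ := (hom_of_real g b Pat ρ hD).2 h
    exact cert_of_real g b Pat ρ hD hG

/-- Index type of the relevant query nodes. -/
abbrev NI (I Θ : Type) (K : ℕ) : Type := Fin 3 ⊕ I ⊕ (Θ × Fin K) ⊕ (I × Θ) ⊕ Θ

/-- The relevant query nodes. -/
def niNd {K : ℕ} : NI I Θ K → Nd I Θ
  | .inl 0 => .x
  | .inl 1 => .w
  | .inl 2 => .W
  | .inr (.inl i) => .y i
  | .inr (.inr (.inl (θ, k))) => .u θ k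
  | .inr (.inr (.inr (.inl (a, θ)))) => .t a θ
  | .inr (.inr (.inr (.inr θ))) => .s θ

/-- All atoms over the relevant nodes. -/
def allAt {K : ℕ} : (NI I Θ K ⊕ NI I Θ K ⊕ NI I Θ K ⊕ (RelS I Θ × NI I Θ K × NI I Θ K)) →
    At ℕ (Nd I Θ)
  | .inl v => .F (niNd v)
  | .inr (.inl v) => .T (niNd v)
  | .inr (.inr (.inl v)) => .A (niNd v)
  | .inr (.inr (.inr (r, v, v'))) => .R (ρ r) (niNd v) (niNd v')

theorem edge_ni {K : ℕ} (hK : ∀ θ, g θ + 2 < K) {r : RelS I Θ} {v v' : Nd I Θ}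
    (h : Edge g b Pat r v v') :
    v ∈ Set.range (niNd (I := I) (Θ := Θ) (K := K)) ∧
    v' ∈ Set.range (niNd (I := I) (Θ := Θ) (K := K)) := by
  have hx : Nd.x ∈ Set.range (niNd (I := I) (Θ := Θ) (K := K)) := ⟨.inl 0, rfl⟩
  have hw : Nd.w ∈ Set.range (niNd (I := I) (Θ := Θ) (K := K)) := ⟨.inl 1, rfl⟩
  have hW : Nd.W ∈ Set.range (niNd (I := I) (Θ := Θ) (K := K)) := ⟨.inl 2, rfl⟩
  have hy : ∀ i, Nd.y i ∈ Set.range (niNd (I := I) (Θ := Θ) (K := K)) :=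
    fun i => ⟨.inr (.inl i), rfl⟩
  have hu : ∀ θ k, k < K → Nd.u θ k ∈ Set.range (niNd (I := I) (Θ := Θ) (K := K)) :=
    fun θ k hk => ⟨.inr (.inr (.inl (θ, ⟨k, hk⟩))), rfl⟩
  have ht : ∀ a θ, Nd.t a θ ∈ Set.range (niNd (I := I) (Θ := Θ) (K := K)) :=
    fun a θ => ⟨.inr (.inr (.inr (.inl (a, θ)))), rfl⟩
  have hs : ∀ θ, Nd.s θ ∈ Set.range (niNd (I := I) (Θ := Θ) (K := K)) :=
    fun θ => ⟨.inr (.inr (.inr (.inr θ))), rfl⟩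
  cases h with
  | xY i => exact ⟨hx, hy i⟩
  | xA i => exact ⟨hx, hy i⟩
  | xR θ => exact ⟨hx, hu θ 0 (by have := hK θ; omega)⟩
  | uA θ k hk _ => exact ⟨hu _ _ (by have := hK θ; omega), hu _ _ (by have := hK θ; omega)⟩
  | uY θ => exact ⟨hu _ _ (by have := hK θ; omega), hu _ _ (by have := hK θ; omega)⟩
  | tY a θ i _ => exact ⟨ht _ _, hw⟩
  | tA a θ _ => exact ⟨ht _ _, hw⟩
  | tR a θ _ => exact ⟨ht _ _, hy _⟩
  | tW a θ _ _ _ => exact ⟨ht _ _, hW⟩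
  | sY θ i => exact ⟨hs _, hw⟩
  | sA θ => exact ⟨hs _, hw⟩
  | sR θ => exact ⟨hs _, hw⟩
  | sW θ _ _ => exact ⟨hs _, hW⟩
  | WY i => exact ⟨hW, hW⟩
  | WA => exact ⟨hW, hW⟩

theorem tw_ni (K : ℕ) {v : Nd I Θ} (h : Tw Pat v) :
    v ∈ Set.range (niNd (I := I) (Θ := Θ) (K := K)) := by
  cases h with
  | t a θ _ => exact ⟨.inr (.inr (.inr (.inl (a, θ)))), rfl⟩
  | s θ => exact ⟨.inr (.inr (.inr (.inr θ))), rfl⟩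
  | w => exact ⟨.inl 1, rfl⟩

theorem qry_sub {K : ℕ} (hK : ∀ θ, g θ + 2 < K) :
    qry g b Pat ρ ⊆ Set.range (allAt (K := K) ρ) := by
  rintro (v | v | v | ⟨k, v, v'⟩) ha
  · rcases ha with h | rfl
    · obtain ⟨n, rfl⟩ := tw_ni Pat K h
      exact ⟨.inl n, rfl⟩
    · exact ⟨.inl (.inl 0), rfl⟩
  · rcases ha with h | ⟨i, rfl⟩
    · obtain ⟨n, rfl⟩ := tw_ni Pat K h
      exact ⟨.inr (.inl n), rfl⟩
    · exact ⟨.inr (.inl (.inr (.inl i))), rfl⟩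
  · exact ha.elim
  · obtain ⟨r, rfl, he⟩ := ha
    obtain ⟨⟨n, rfl⟩, ⟨n', rfl⟩⟩ := edge_ni g b Pat hK he
    exact ⟨.inr (.inr (.inr (r, n, n'))), rfl⟩

theorem cac_finite [Finite I] [Finite Θ] {K : ℕ} (hK : ∀ θ, g θ + 2 < K) {D : Set (List I)} (hD : Skel D) :
    (cac g b Pat ρ D).Finite := by
  have hsub : cac g b Pat ρ D ⊆
      ⋃ w ∈ D, At.map (nd w) '' (Set.range (allAt (K := K) ρ)) := by
    rintro (v | v | v | ⟨k, v, v'⟩) ha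
    · rcases ha with rfl | ⟨w, hw, v, hv, rfl⟩
      · exact Set.mem_biUnion hD.nil ⟨.F .x, ⟨.inl (.inl 0), rfl⟩, rfl⟩
      · obtain ⟨n, rfl⟩ := tw_ni Pat K hv
        exact Set.mem_biUnion hw ⟨_, ⟨.inl n, rfl⟩, rfl⟩
    · rcases ha with ⟨w, hw, i, hi, rfl⟩ | ⟨w, hw, v, hv, rfl⟩
      · exact Set.mem_biUnion hw ⟨.T (.y i), ⟨.inr (.inl (.inr (.inl i))), rfl⟩, rfl⟩
      · obtain ⟨n, rfl⟩ := tw_ni Pat K hv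
        exact Set.mem_biUnion hw ⟨_, ⟨.inr (.inl n), rfl⟩, rfl⟩
    · obtain ⟨w, hw, hne, rfl⟩ := ha
      exact Set.mem_biUnion hw ⟨.A .x, ⟨.inr (.inr (.inl (.inl 0))), rfl⟩, rfl⟩
    · obtain ⟨r, rfl, w, hw, v, v', he, rfl, rfl⟩ := ha
      obtain ⟨⟨n, rfl⟩, ⟨n', rfl⟩⟩ := edge_ni g b Pat hK he
      exact Set.mem_biUnion hw ⟨_, ⟨.inr (.inr (.inr (r, n, n'))), rfl⟩, rfl⟩
  exact (hD.fin.biUnion fun w _ => (Set.finite_range _).image _).subset hsub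

theorem fo_rewr [Finite I] [Finite Θ] [Nonempty I] {K : ℕ} (hK : ∀ θ, g θ + 2 < K) (M : ℕ)
    (hM : ∀ D : Set (List I), Skel D → ¬ Err g b Pat D → ∀ w ∈ D, w.length ≤ M) :
    ∃ Φ : (Lsig ℕ).Sentence, ∀ (α : Type) (A : Set (At ℕ α)),
      (covACert A (qry g b Pat ρ) ↔ foHolds A Φ) := by
  let X : Set (Set (List I)) := {D | Skel D ∧ ¬ Err g b Pat D}
  have hX : X.Finite := by
    have hfin : {w : List I | w.length ≤ M}.Finite := List.finite_length_le I M
    exact hfin.finite_subsets.subset (fun D hD w hw => hM D hD.1 hD.2 w hw)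
  haveI : Finite X := hX
  obtain ⟨Φ, hΦ⟩ := ucq_fo (fun D : X => cac g b Pat ρ D.1)
    (fun D => cac_finite g b Pat ρ hK D.2.1) (fun D => ⟨.F (.word []), Or.inl rfl⟩)
  refine ⟨Φ, fun α A => ?_⟩
  rw [← hΦ, cert_iff]
  constructor
  · rintro ⟨D, hD, h⟩; exact ⟨⟨D, hD⟩, h⟩
  · rintro ⟨⟨D, hD⟩, h⟩; exact ⟨D, hD, h⟩

/-! lower bounds, for an injective family of error-free skeletons -/

theorem ucq_lower [Finite I] [Finite Θ] [Nonempty I] (hρ : Function.Injective ρ) {K : ℕ}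
    (hK : ∀ θ, g θ + 2 < K) {V : Type} (q : Set (At ℕ V))
    (hq : ∀ (α : Type) (A : Set (At ℕ α)), covACert A q ↔ covACert A (qry g b Pat ρ))
    {ι : Type} [Fintype ι] (E : ι → Set (List I)) (hE : Function.Injective E)
    (hS : ∀ j, Skel (E j)) (hn : ∀ j, ¬ Err g b Pat (E j))
    (k : ℕ) (f : Fin k → Set (At ℕ ℕ)) (hf : isUCQRewritingA q k f) :
    Fintype.card ι ≤ ∑ i, (f i).ncard := by
  have h1 : ∀ j, ∃ i, (toInterp (cac g b Pat ρ (E j))).satCQ (f i) := by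
    intro j
    rw [← hf.2 _ _ (cac_finite g b Pat ρ hK (hS j)), hq]
    exact cert_of_real g b Pat ρ (hS j) (real_cac g b Pat ρ (E j))
  choose c hc using h1
  have hinj : Function.Injective c := by
    intro j j' hj
    apply hE
    apply eq_of_prod g b Pat ρ hρ (hS j) (hS j') (hn j) (hn j')
    rw [← hq, hf.2 _ _ (prodA_finite (cac_finite g b Pat ρ hK (hS j))
      (cac_finite g b Pat ρ hK (hS j')))]
    refine ⟨c j, ?_⟩
    obtain ⟨h, hh⟩ := hc j
    obtain ⟨h', hh'⟩ := hc j'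
    rw [← hj] at hh'
    refine ⟨fun v => (h v, h' v), ?_⟩
    intro a ha
    have e1 := hh a ha
    have e2 := hh' a ha
    cases a <;> exact ⟨e1, e2⟩
  have hpos : ∀ i, 1 ≤ (f i).ncard := by
    intro i
    rw [Nat.one_le_iff_ne_zero, Ne, Set.ncard_eq_zero (hf.1 i)]
    intro h0
    have : covACert (∅ : Set (At ℕ Unit)) q := by
      rw [hf.2 _ _ Set.finite_empty]
      exact ⟨i, fun _ => (), by simp [h0]⟩
    rw [hq] at this
    obtain ⟨h, hh⟩ := this (fun _ => true)
    have := hh (.F .x) (Or.inr rfl)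
    simp [At.map, Interp.satAt, minModel, undecided] at this
  calc Fintype.card ι ≤ Fintype.card (Fin k) := Fintype.card_le_of_injective c hinj
    _ = ∑ i : Fin k, 1 := by simp
    _ ≤ _ := Finset.sum_le_sum fun i _ => hpos i

theorem pe_lower [Finite I] [Finite Θ] [Nonempty I] (hρ : Function.Injective ρ) {K : ℕ}
    (hK : ∀ θ, g θ + 2 < K) {V : Type} (q : Set (At ℕ V))
    (hq : ∀ (α : Type) (A : Set (At ℕ α)), covACert A q ↔ covACert A (qry g b Pat ρ))
    {ι : Type} [Fintype ι] (E : ι → Set (List I)) (hE : Function.Injective E)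
    (hS : ∀ j, Skel (E j)) (hn : ∀ j, ¬ Err g b Pat (E j))
    (φ : PE ℕ) (hf : isPERewritingA q φ) :
    Fintype.card ι ≤ 2 ^ φ.size := by
  have h1 : ∀ j, ∃ i : Fin φ.dnf.length,
      (φ.dnf.get i).Realize (cac g b Pat ρ (E j)) (fun _ => .word []) := by
    intro j
    have h2 : φ.Realize (cac g b Pat ρ (E j)) (fun _ => .word []) := by
      rw [← hf _ _ (cac_finite g b Pat ρ hK (hS j)), hq]
      exact cert_of_real g b Pat ρ (hS j) (real_cac g b Pat ρ (E j))
    rw [PE.realize_dnf] at h2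
    obtain ⟨ψ, hψ, h3⟩ := h2
    obtain ⟨i, rfl⟩ := List.get_of_mem hψ
    exact ⟨i, h3⟩
  choose c hc using h1
  have hinj : Function.Injective c := by
    intro j j' hj
    apply hE
    apply eq_of_prod g b Pat ρ hρ (hS j) (hS j') (hn j) (hn j')
    rw [← hq, hf _ _ (prodA_finite (cac_finite g b Pat ρ hK (hS j))
      (cac_finite g b Pat ρ hK (hS j'))) (fun _ => (.word [], .word [])), PE.realize_dnf]
    have h2 := hc j'
    rw [← hj] at h2
    exact ⟨_, List.get_mem _ _, PE.realize_prod _ _ _ (PE.dnf_dfree _ _ (List.get_mem _ _)) (hc j) h2⟩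
  calc Fintype.card ι ≤ Fintype.card (Fin φ.dnf.length) := Fintype.card_le_of_injective c hinj
    _ = φ.dnf.length := by simp
    _ ≤ _ := φ.dnf_length

/-! connectedness and encoding into natural numbers -/

theorem countable_nd [Finite I] [Finite Θ] : Countable (Nd I Θ) := by
  let f : Nd I Θ → Fin 3 ⊕ I ⊕ (Θ × ℕ) ⊕ (I × Θ) ⊕ Θ := fun v => match v with
    | .x => .inl 0
    | .w => .inl 1
    | .W => .inl 2
    | .y i => .inr (.inl i)
    | .u θ k => .inr (.inr (.inl (θ, k)))
    | .t a θ => .inr (.inr (.inr (.inl (a, θ))))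
    | .s θ => .inr (.inr (.inr (.inr θ)))
  have hf : Function.Injective f := by
    intro v v' h
    cases v <;> cases v' <;> simp_all [f]
  exact hf.countable

theorem satCQ_image {σ δ V U : Type} [Nonempty V] (J : Interp σ δ) (q : Set (At σ V)) (e : V → U)
    (he : Function.Injective e) : J.satCQ (At.map e '' q) ↔ J.satCQ q := by
  have hm : ∀ {X Y Z : Type} (p : X → Y) (r : Y → Z) (a : At σ X),
      At.map r (At.map p a) = At.map (fun z => r (p z)) a := by
    intro X Y Z p r a; cases a <;> rfl
  constructor
  · rintro ⟨h, hh⟩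
    refine ⟨fun v => h (e v), fun a ha => ?_⟩
    rw [← hm]
    exact hh _ ⟨a, ha, rfl⟩
  · rintro ⟨h, hh⟩
    refine ⟨fun v => h (Function.invFun e v), ?_⟩
    rintro _ ⟨a, ha, rfl⟩
    rw [hm]
    simpa [Function.leftInverse_invFun he _] using hh a ha

theorem vars_map {σ V U : Type} (e : V → U) (a : At σ V) : At.vars (At.map e a) = e '' At.vars a := by
  cases a <;> simp [At.vars, At.map, Set.image_pair]

theorem conn_image {σ V U : Type} (q : Set (At σ V)) (e : V → U) (h : connCQ q) :
    connCQ (At.map e '' q) := by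
  rintro x y ⟨_, ⟨a, ha, rfl⟩, hx⟩ ⟨_, ⟨c, hc, rfl⟩, hy⟩
  rw [vars_map] at hx hy
  obtain ⟨x, hx, rfl⟩ := hx
  obtain ⟨y, hy, rfl⟩ := hy
  have := h x y ⟨a, ha, hx⟩ ⟨c, hc, hy⟩
  refine Relation.ReflTransGen.lift e ?_ _ _ this
  rintro u v ⟨d, hd, hu, hv⟩
  exact ⟨_, ⟨d, hd, rfl⟩, by rw [vars_map]; exact ⟨u, hu, rfl⟩, by rw [vars_map]; exact ⟨v, hv, rfl⟩⟩

theorem qry_conn (hne : ∃ a θ θ', Pat a θ ∧ θ' ≠ θ) : connCQ (qry g b Pat ρ) := by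
  set C : Nd I Θ → Nd I Θ → Prop :=
    fun u v => ∃ a ∈ qry g b Pat ρ, u ∈ At.vars a ∧ v ∈ At.vars a with hC
  have hsym : ∀ u v, C u v → C v u := fun u v ⟨a, ha, hu, hv⟩ => ⟨a, ha, hv, hu⟩
  have hE : ∀ r u v, Edge g b Pat r u v → Relation.ReflTransGen C u v := by
    intro r u v h
    exact .single ⟨.R (ρ r) u v, ⟨r, rfl, h⟩, by simp [At.vars], by simp [At.vars]⟩
  have hE' : ∀ r u v, Edge g b Pat r u v → Relation.ReflTransGen C v u := by
    intro r u v h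
    exact .single ⟨.R (ρ r) u v, ⟨r, rfl, h⟩, by simp [At.vars], by simp [At.vars]⟩
  have hy : ∀ i, Relation.ReflTransGen C (.y i) .x := fun i => hE' _ _ _ (.xY i)
  have ht : ∀ a θ, Pat a θ → Relation.ReflTransGen C (.t a θ) .x :=
    fun a θ hp => (hE _ _ _ (.tR a θ hp)).trans (hy a)
  obtain ⟨a, θ, θ', hp, hθ⟩ := hne
  have hw : Relation.ReflTransGen C .w .x := (hE' _ _ _ (.tA a θ hp)).trans (ht a θ hp)
  have hW : Relation.ReflTransGen C .W .x := (hE' _ _ _ (.tW a θ θ' hp hθ)).trans (ht a θ hp)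
  have hs : ∀ θ, Relation.ReflTransGen C (.s θ) .x := fun θ => (hE _ _ _ (.sA θ)).trans hw
  have hu : ∀ θ k, k ≤ g θ + 2 → Relation.ReflTransGen C (.u θ k) .x := by
    intro θ k
    induction k with
    | zero => intro _; exact hE' _ _ _ (.xR θ)
    | succ k ih =>
      intro hk
      by_cases h : k = g θ
      · subst h; exact (hE' _ _ _ (.uY θ)).trans (ih (by omega))
      · exact (hE' _ _ _ (.uA θ k (by omega) h)).trans (ih (by omega))
  have htw : ∀ v, Tw Pat v → Relation.ReflTransGen C v .x := by
    intro v hv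
    cases hv with
    | t a θ hp => exact ht a θ hp
    | s θ => exact hs θ
    | w => exact hw
  have hedge : ∀ r u v, Edge g b Pat r u v → Relation.ReflTransGen C u .x := by
    intro r u v h
    cases h with
    | xY i => exact .refl
    | xA i => exact .refl
    | xR θ => exact .refl
    | uA θ k hk _ => exact hu _ _ (by omega)
    | uY θ => exact hu _ _ (by omega)
    | tY a θ i hp => exact ht _ _ hp
    | tA a θ hp => exact ht _ _ hp
    | tR a θ hp => exact ht _ _ hp
    | tW a θ _ hp _ => exact ht _ _ hp
    | sY θ i => exact hs _
    | sA θ => exact hs _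
    | sR θ => exact hs _
    | sW θ _ _ => exact hs _
    | WY i => exact hW
    | WA => exact hW
  have hall : ∀ v, occ (qry g b Pat ρ) v → Relation.ReflTransGen C v .x := by
    rintro v ⟨(n | n | n | ⟨k, n, n'⟩), ha, hv⟩
    · obtain rfl : v = n := hv
      rcases ha with h | rfl
      · exact htw _ h
      · exact .refl
    · obtain rfl : v = n := hv
      rcases ha with h | ⟨i, rfl⟩
      · exact htw _ h
      · exact hy i
    · exact ha.elim
    · obtain ⟨r, rfl, he⟩ := ha
      rcases hv with rfl | hv
      · exact hedge _ _ _ he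
      · obtain rfl : v = n' := hv
        exact (hE' _ _ _ he).trans (hedge _ _ _ he)
  have hrev : ∀ u v, Relation.ReflTransGen C u v → Relation.ReflTransGen C v u := by
    intro u v h
    induction h with
    | refl => exact .refl
    | tail _ h2 ih => exact .head (hsym _ _ h2) ih
  intro v v' hv hv'
  exact (hall v hv).trans (hrev _ _ (hall v' hv'))

end main
section counter

/-- Carry bits for incrementing `B`. -/
def carry (B : ℕ → Bool) : ℕ → Bool
  | 0 => true
  | i + 1 => B i && carry B i

/-- Value of the low `k` bits. -/
def bval (B : ℕ → Bool) (k : ℕ) : ℕ := ∑ i ∈ Finset.range k, (B i).toNat * 2 ^ i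

theorem bval_lt (B : ℕ → Bool) (k : ℕ) : bval B k < 2 ^ k := by
  induction k with
  | zero => simp [bval]
  | succ k ih =>
    unfold bval at *
    rw [Finset.sum_range_succ, pow_succ]
    cases B k <;> simp <;> omega

theorem bval_step (B B' : ℕ → Bool) (k : ℕ) (h : ∀ i < k, B' i = xor (B i) (carry B i)) :
    bval B' k + (carry B k).toNat * 2 ^ k = bval B k + 1 := by
  induction k with
  | zero => simp [bval, carry]
  | succ k ih =>
    have ih := ih (fun i hi => h i (by omega))
    unfold bval at *
    rw [Finset.sum_range_succ, Finset.sum_range_succ, pow_succ, h k (by omega)]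
    simp only [carry]
    cases hB : B k <;> cases hc : carry B k <;> simp [hB, hc] at ih ⊢ <;> omega

/-- The sequence of counter values. -/
def cnt : ℕ → ℕ → Bool
  | 0 => fun _ => false
  | m + 1 => fun i => xor (cnt m i) (carry (cnt m) i)

theorem bval_cnt (n m : ℕ) (h : m < 2 ^ n) : bval (cnt m) n = m := by
  induction m with
  | zero => simp [bval, cnt]
  | succ m ih =>
    have h1 := bval_step (cnt m) (cnt (m + 1)) n (fun i _ => rfl)
    rw [ih (by omega)] at h1
    cases hc : carry (cnt m) n <;> simp [hc] at h1 <;> omega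

theorem carry_cnt (n m : ℕ) (h : m + 1 < 2 ^ n) : carry (cnt m) n = false := by
  have h1 := bval_step (cnt m) (cnt (m + 1)) n (fun i _ => rfl)
  rw [bval_cnt n m (by omega), bval_cnt n (m + 1) h] at h1
  cases hc : carry (cnt m) n
  · rfl
  · simp [hc] at h1

/-- Successor condition of letters. -/
def Nxt (n : ℕ) (p : ℕ) (β γ : Bool) (p' : ℕ) (γ' : Bool) : Prop :=
  if p + 1 < n then p' = p + 1 ∧ γ' = (β && γ) else p' = 0 ∧ γ' = true ∧ (β && γ) = false

theorem no_long (n : ℕ) (hn : 0 < n) (p : ℕ → ℕ) (β γ : ℕ → Bool) (T : ℕ)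
    (hT : n * (2 ^ n + 4) ≤ T) (hp : ∀ t < T, p t < n)
    (hN : ∀ t, t + 1 < T → Nxt n (p t) (β t) (γ t) (p (t + 1)) (γ (t + 1)))
    (hX : ∀ t, t + n < T → β (t + n) = xor (β t) (γ t)) : False := by
  have hT' : n * 2 ^ n + 4 * n ≤ T := by nlinarith
  have hpos : 0 < n * 2 ^ n := by positivity
  obtain ⟨t0, ht0, hp0, hg0⟩ : ∃ t0, t0 ≤ n ∧ p t0 = 0 ∧ γ t0 = true := by
    have h1 : ∀ t, p 0 + t < n → p t = p 0 + t := by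
      intro t
      induction t with
      | zero => simp
      | succ t ih =>
        intro h
        have h2 := ih (by omega)
        have h3 := hN t (by omega)
        rw [Nxt, if_pos (by omega)] at h3
        omega
    have h0 := hp 0 (by omega)
    have h2 := h1 (n - 1 - p 0) (by omega)
    have h3 := hN (n - 1 - p 0) (by omega)
    rw [Nxt, if_neg (by omega)] at h3
    exact ⟨_, by omega, h3.1, h3.2.1⟩
  have hs : ∀ s, t0 + s < T → p (t0 + s) = s % n ∧ (s % n = 0 → γ (t0 + s) = true) := by
    intro s
    induction s with
    | zero => intro _; exact ⟨by simpa using hp0, fun _ => hg0⟩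
    | succ s ih =>
      intro h
      have h1 := (ih (by omega)).1
      have h2 := hN (t0 + s) (by omega)
      have hlt := Nat.mod_lt s hn
      rw [show t0 + (s + 1) = t0 + s + 1 by ring]
      unfold Nxt at h2
      split_ifs at h2 with h3
      · have : (s + 1) % n = s % n + 1 := by
          rw [Nat.add_mod, Nat.mod_eq_of_lt (a := 1) (by omega), Nat.mod_eq_of_lt (by omega)]
        rw [this]
        exact ⟨by omega, by omega⟩
      · have : (s + 1) % n = 0 := by
          rw [← Nat.mod_add_mod, show s % n + 1 = n by omega, Nat.mod_self]
        rw [this]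
        exact ⟨h2.1, fun _ => h2.2.1⟩
  have hmn : ∀ m i, (n * m + i < n * 2 ^ n + 2 * n) → i < n →
      γ (t0 + (n * m + i)) = carry (fun j => β (t0 + (n * m + j))) i := by
    intro m i hb hi
    induction i with
    | zero =>
      refine (hs (n * m + 0) (by omega)).2 ?_
      simp
    | succ i ih =>
      have h1 := (hs (n * m + i) (by omega)).1
      have h2 := hN (t0 + (n * m + i)) (by omega)
      rw [Nat.mul_add_mod, Nat.mod_eq_of_lt (by omega)] at h1
      rw [Nxt, if_pos (by omega)] at h2
      rw [carry, ← ih (by omega) (by omega)]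
      exact h2.2
  have hV : ∀ m, m ≤ 2 ^ n → m ≤ bval (fun j => β (t0 + (n * m + j))) n := by
    intro m
    induction m with
    | zero => intro _; exact Nat.zero_le _
    | succ m ih =>
      intro hm
      have ih := ih (by omega)
      have hb : n * m + n ≤ n * 2 ^ n := by nlinarith
      have h1 := bval_step (fun j => β (t0 + (n * m + j))) (fun j => β (t0 + (n * (m + 1) + j))) n
        (by
          intro i hi
          rw [← hmn m i (by omega) hi]
          have := hX (t0 + (n * m + i)) (by omega)
          rw [← this]
          congr 1; ring)
      have hc : carry (fun j => β (t0 + (n * m + j))) n = false := by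
        obtain ⟨k, rfl⟩ : ∃ k, n = k + 1 := ⟨n - 1, by omega⟩
        rw [carry, ← hmn m k (by omega) (by omega)]
        have h2 := (hs ((k + 1) * m + k) (by omega)).1
        rw [Nat.mul_add_mod, Nat.mod_eq_of_lt (by omega)] at h2
        have h3 := hN (t0 + ((k + 1) * m + k)) (by omega)
        rw [Nxt, if_neg (by omega)] at h3
        exact h3.2.2
      rw [hc] at h1
      simp at h1
      omega
  have := hV (2 ^ n) le_rfl
  have := bval_lt (fun j => β (t0 + (n * 2 ^ n + j))) n
  omega

theorem cnt_next (n : ℕ) (hn : 0 < n) (t : ℕ) (ht : t < n * (2 ^ n - 1)) :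
    Nxt n (t % n) (cnt (t / n) (t % n)) (carry (cnt (t / n)) (t % n)) ((t + 1) % n)
      (carry (cnt ((t + 1) / n)) ((t + 1) % n)) := by
  have hlt := Nat.mod_lt t hn
  have hd := Nat.div_add_mod t n
  unfold Nxt
  split_ifs with h
  · have h1 : (t + 1) / n = t / n ∧ (t + 1) % n = t % n + 1 := by
      rw [Nat.div_mod_unique hn]
      exact ⟨by omega, h⟩
    rw [h1.1, h1.2]
    exact ⟨rfl, rfl⟩
  · have h1 : (t + 1) / n = t / n + 1 ∧ (t + 1) % n = 0 := by
      rw [Nat.div_mod_unique hn]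
      refine ⟨?_, hn⟩
      rw [mul_add]; omega
    rw [h1.2]
    refine ⟨rfl, rfl, ?_⟩
    have h2 : t / n < 2 ^ n - 1 := by
      rw [Nat.div_lt_iff_lt_mul hn, mul_comm]; exact ht
    have h3 := carry_cnt n (t / n) (Nat.add_lt_of_lt_sub h2)
    have h4 : ∀ k, k = t % n + 1 → carry (cnt (t / n)) k =
        (cnt (t / n) (t % n) && carry (cnt (t / n)) (t % n)) := by rintro k rfl; rfl
    rw [← h3, h4 n (by omega)]

theorem cnt_xor (n : ℕ) (hn : 0 < n) (t : ℕ) :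
    cnt ((t + n) / n) ((t + n) % n) =
      xor (cnt (t / n) (t % n)) (carry (cnt (t / n)) (t % n)) := by
  rw [Nat.add_div_right _ hn, Nat.add_mod_right]
  rfl

end counter

section inst

variable {I Θ : Type} (g : Θ → ℕ) (b : Θ → I) (Pat : I → Θ → Prop)

theorem noerr_get {D : Set (List I)} (hD : Skel D) (he : ¬ Err g b Pat D) {l : List I} (hl : l ∈ D)
    (θ : Θ) (t : ℕ) (ht : t + g θ + 1 < l.length) (hb : l[t + g θ + 1] = b θ) :
    ¬ Pat l[t] θ := by
  intro hp
  apply he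
  refine ⟨l.take t, l[t], θ, (l.drop (t + 1)).take (g θ), hp, ?_, ?_⟩
  · simp; omega
  · have : l.take t ++ [(l[t])] ++ (l.drop (t + 1)).take (g θ) ++ [b θ] = l.take (t + g θ + 2) := by
      apply List.ext_getElem
      · simp; omega
      · intro i h1 h2
        simp only [List.getElem_take, List.getElem_append, List.length_append, List.length_take,
          List.length_singleton, List.getElem_singleton, List.length_drop, List.getElem_drop]
        simp at h2
        split_ifs with a1 a2 a3
        · rfl
        · congr 1; omega
        · congr 1; omega
        · rw [← hb]; congr 1; omega
    rw [this]
    exact hD.pre (l.drop (t + g θ + 2)) _ (by rw [List.take_append_drop]; exact hl)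

theorem err_get {D : Set (List I)} (he : Err g b Pat D) : ∃ l ∈ D, ∃ θ t,
    ∃ ht : t + g θ + 1 < l.length, l[t + g θ + 1] = b θ ∧ Pat l[t] θ := by
  obtain ⟨w, a, θ, l, hp, hg, h⟩ := he
  refine ⟨_, h, θ, w.length, by simp; omega, ?_, ?_⟩
  · rw [List.getElem_append_right (by simp; omega)]
    simp [hg]
  · simpa [List.getElem_append] using hp

/-- Letters. -/
abbrev Let (n : ℕ) : Type := Fin n × Bool × Bool × Bool

/-- Tests. -/
abbrev Tst (n : ℕ) : Type := Bool × Let n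

/-- Gap lengths. -/
def gp (n : ℕ) (θ : Tst n) : ℕ := if θ.1 then n - 1 else 0

/-- Forbidden patterns. -/
def Pt (n : ℕ) (a : Let n) (θ : Tst n) : Prop :=
  if θ.1 then θ.2.2.1 ≠ xor a.2.1 a.2.2.1
  else ¬ Nxt n a.1 a.2.1 a.2.2.1 θ.2.1 θ.2.2.2.1

theorem bounded (n : ℕ) (hn : 0 < n) (D : Set (List (Let n))) (hD : Skel D)
    (he : ¬ Err (gp n) Prod.snd (Pt n) D) (w : List (Let n)) (hw : w ∈ D) :
    w.length ≤ n * (2 ^ n + 4) := by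
  by_contra hlen
  push Not at hlen
  let d : Let n := (⟨0, hn⟩, false, false, false)
  have hg : ∀ t (h : t < w.length), w.getD t d = w[t] := fun t h => List.getD_eq_getElem _ _ h
  refine no_long n hn (fun t => ((w.getD t d).1 : ℕ)) (fun t => (w.getD t d).2.1)
    (fun t => (w.getD t d).2.2.1) w.length hlen.le (fun t _ => Fin.is_lt _) ?_ ?_
  · intro t ht
    have := noerr_get (gp n) Prod.snd (Pt n) hD he hw (false, w[t + 1]) t (by simpa [gp] using ht)
      (by simp [gp])
    simp only [Pt, Bool.false_eq_true, if_false, not_not] at this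
    simpa only [hg t (by omega), hg (t + 1) ht] using this
  · intro t ht
    have hgp : ∀ c : Let n, t + gp n (true, c) + 1 = t + n := by
      intro c; simp [gp]; omega
    have := noerr_get (gp n) Prod.snd (Pt n) hD he hw (true, w[t + n]) t
      (by rw [hgp]; exact ht) (by simp only [hgp])
    simp only [Pt, if_true, not_not, ne_eq] at this
    simpa only [hg t (by omega), hg (t + n) ht] using this

/-- The family of skeletons. -/
def fam (n L : ℕ) (X : Set (Fin L → Bool)) : Set (List (Let n)) :=
  {l | l.length ≤ L ∧ (∀ t (h : t < l.length), (l[t].1 : ℕ) = t % n ∧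
      l[t].2.1 = cnt (t / n) (t % n) ∧ l[t].2.2.1 = carry (cnt (t / n)) (t % n)) ∧
    ∀ h : l.length = L, (fun j : Fin L => (l[(j : ℕ)]'(by rw [h]; exact j.2)).2.2.2) ∈ X}

theorem fam_skel (n L : ℕ) (hL : 0 < L) (X : Set (Fin L → Bool)) : Skel (fam n L X) where
  fin := (List.finite_length_le (Let n) L).subset fun l hl => hl.1
  nil := ⟨by simp, by simp, by intro h; simp at h; omega⟩
  cl := by
    rintro w i ⟨h1, h2, _⟩
    simp only [List.length_append, List.length_singleton] at h1
    refine ⟨by omega, ?_, by intro h; omega⟩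
    intro t h
    have := h2 t (by simp; omega)
    simpa [List.getElem_append, h] using this

theorem fam_noerr (n L : ℕ) (hn : 0 < n) (hL : L ≤ n * (2 ^ n - 1)) (X : Set (Fin L → Bool)) :
    ¬ Err (gp n) Prod.snd (Pt n) (fam n L X) := by
  intro he
  obtain ⟨l, hl, ⟨k, c⟩, t, ht, hb, hp⟩ := err_get _ _ _ he
  have h1 := hl.2.1 t (by omega)
  have h2 := hl.2.1 _ ht
  have hlen := hl.1
  rw [hb] at h2
  cases k
  · simp only [gp, Bool.false_eq_true, if_false, add_zero] at h2 ht
    simp only [Pt, Bool.false_eq_true, if_false] at hp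
    apply hp
    rw [h1.1, h1.2.1, h1.2.2, h2.1, h2.2.2]
    exact cnt_next n hn t (by omega)
  · simp only [gp, if_true] at h2 ht
    rw [show t + (n - 1) + 1 = t + n by omega] at h2
    simp only [Pt, if_true] at hp
    apply hp
    rw [h1.2.1, h1.2.2, h2.2.1]
    exact cnt_xor n hn t

theorem fam_inj (n L : ℕ) (hn : 0 < n) : Function.Injective (fam n L) := by
  have key : ∀ X X' : Set (Fin L → Bool), fam n L X = fam n L X' → X ⊆ X' := by
    intro X X' h f hf
    have h1 : List.ofFn (fun j : Fin L => ((⟨(j : ℕ) % n, Nat.mod_lt _ hn⟩, cnt (j / n) (j % n),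
        carry (cnt (j / n)) (j % n), f j) : Let n)) ∈ fam n L X := by
      refine ⟨by simp, ?_, ?_⟩
      · intro t h; simp
      · intro h; simpa using hf
    rw [h] at h1
    simpa using h1.2.2 (by simp)
  intro X X' h
  exact Set.Subset.antisymm (key _ _ h) (key _ _ h.symm)

theorem at_card [Finite I] [Finite Θ] (K : ℕ) :
    Finite (NI I Θ K ⊕ NI I Θ K ⊕ NI I Θ K ⊕ (RelS I Θ × NI I Θ K × NI I Θ K)) ∧
    Nat.card (NI I Θ K ⊕ NI I Θ K ⊕ NI I Θ K ⊕ (RelS I Θ × NI I Θ K × NI I Θ K)) =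
      3 * (3 + Nat.card I + Nat.card Θ * K + Nat.card I * Nat.card Θ + Nat.card Θ) +
      (Nat.card I + Nat.card Θ + 1) *
        (3 + Nat.card I + Nat.card Θ * K + Nat.card I * Nat.card Θ + Nat.card Θ) ^ 2 := by
  refine ⟨inferInstance, ?_⟩
  haveI : Fintype I := Fintype.ofFinite I
  haveI : Fintype Θ := Fintype.ofFinite Θ
  simp only [Nat.card_eq_fintype_card, Fintype.card_sum, Fintype.card_prod, Fintype.card_fin,
    Fintype.card_option]
  ring

/-- Everything needed for one value of `n`. -/
theorem main_n (n : ℕ) (hn : 0 < n) : ∃ q : Set (At ℕ ℕ),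
    q.ncard ≤ 3 * (3 + 8 * n + 16 * n * (n + 3) + 8 * n * (16 * n) + 16 * n) +
      (24 * n + 1) * (3 + 8 * n + 16 * n * (n + 3) + 8 * n * (16 * n) + 16 * n) ^ 2 ∧
    (q.Finite ∧ noA q ∧ connCQ q) ∧ (∃ Φ : (Lsig ℕ).Sentence, isFORewritingA q Φ) ∧
    (∀ (k : ℕ) (f : Fin k → Set (At ℕ ℕ)), isUCQRewritingA q k f →
      2 ^ 2 ^ (n * (2 ^ n - 1)) ≤ ∑ i, (f i).ncard) ∧
    (∀ φ : PE ℕ, isPERewritingA q φ → 2 ^ 2 ^ (n * (2 ^ n - 1)) ≤ 2 ^ φ.size) := by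
  haveI : Nonempty (Let n) := ⟨(⟨0, hn⟩, false, false, false)⟩
  haveI : Nonempty (Nd (Let n) (Tst n)) := ⟨.x⟩
  haveI : Countable (Nd (Let n) (Tst n)) := countable_nd
  obtain ⟨e, he⟩ := exists_injective_nat (Nd (Let n) (Tst n))
  obtain ⟨ρ, hρ⟩ := exists_injective_nat (RelS (Let n) (Tst n))
  set Q := qry (gp n) Prod.snd (Pt n) ρ with hQ
  have hK : ∀ θ, gp n θ + 2 < n + 3 := by
    intro θ; unfold gp; split_ifs <;> omega
  have hq : ∀ (α : Type) (A : Set (At ℕ α)), covACert A (At.map e '' Q) ↔ covACert A Q := by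
    intro α A
    exact forall_congr' fun c => satCQ_image _ _ _ he
  have hsub := qry_sub (gp n) Prod.snd (Pt n) ρ hK
  obtain ⟨hF, hC⟩ := at_card (I := Let n) (Θ := Tst n) (n + 3)
  have hfin : Q.Finite := (Set.finite_range _).subset hsub
  have hL : 0 < n * (2 ^ n - 1) := by
    have : 1 < 2 ^ n := Nat.one_lt_two_pow (by omega)
    exact Nat.mul_pos hn (by omega)
  have hcard : Fintype.card (Set (Fin (n * (2 ^ n - 1)) → Bool)) = 2 ^ 2 ^ (n * (2 ^ n - 1)) := by
    simp
  refine ⟨At.map e '' Q, ?_, ⟨hfin.image _, ?_, ?_⟩, ?_, ?_, ?_⟩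
  · refine (Set.ncard_image_le hfin).trans ?_
    refine (Set.ncard_le_ncard hsub (Set.finite_range _)).trans ?_
    rw [← Nat.card_coe_set_eq]
    refine (Finite.card_range_le _).trans ?_
    rw [hC]
    simp only [Nat.card_eq_fintype_card, Fintype.card_prod, Fintype.card_fin, Fintype.card_bool]
    apply le_of_eq
    ring
  · rintro v ⟨a, ha, h⟩
    cases a <;> simp [At.map] at h
    exact ha
  · apply conn_image
    apply qry_conn
    exact ⟨(⟨0, hn⟩, false, false, false), (true, (⟨0, hn⟩, true, false, false)),
      (false, (⟨0, hn⟩, true, false, false)), by simp [Pt], by simp⟩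
  · obtain ⟨Φ, hΦ⟩ := fo_rewr (gp n) Prod.snd (Pt n) ρ hK _ (bounded n hn)
    exact ⟨Φ, fun α A _ => by rw [hq]; exact hΦ α A⟩
  · intro k f hf
    rw [← hcard]
    exact ucq_lower (gp n) Prod.snd (Pt n) ρ hρ hK _ hq (fam n _) (fam_inj n _ hn)
      (fam_skel n _ hL) (fam_noerr n _ hn le_rfl) k f hf
  · intro φ hf
    rw [← hcard]
    exact pe_lower (gp n) Prod.snd (Pt n) ρ hρ hK _ hq (fam n _) (fam_inj n _ hn)
      (fam_skel n _ hL) (fam_noerr n _ hn le_rfl) φ hf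

end inst

/-- There exist a constant `c > 0` and a sequence of
FO-rewritable d-sirups `Q_n = (cov_A, q_n)`, `n > 0`, with `q_n` of size bounded
by a polynomial in `n`, such that for all sufficiently large `n` every
UCQ-rewriting of `Q_n` has size at least `2^(2^(2^(c·n)))` and every
PE-rewriting of `Q_n` has size at least `2^(2^(c·n))`. -/
theorem statement_9 :
    ∃ (qseq : ℕ → Set (At ℕ ℕ)) (c : ℝ), 0 < c ∧
      (∃ P : Polynomial ℕ, ∀ n, 0 < n → (qseq n).ncard ≤ P.eval n) ∧
      (∀ n, 0 < n → (qseq n).Finite ∧ noA (qseq n) ∧ connCQ (qseq n)) ∧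
      (∀ n, 0 < n → ∃ Φ : (Lsig ℕ).Sentence, isFORewritingA (qseq n) Φ) ∧
      (∃ N : ℕ, ∀ n, N ≤ n →
        (∀ (k : ℕ) (f : Fin k → Set (At ℕ ℕ)), isUCQRewritingA (qseq n) k f →
          (2 : ℝ) ^ ((2 : ℝ) ^ ((2 : ℝ) ^ (c * (n : ℝ)))) ≤ ∑ i, ((f i).ncard : ℝ)) ∧
        (∀ φ : PE ℕ, isPERewritingA (qseq n) φ →
          (2 : ℝ) ^ ((2 : ℝ) ^ (c * (n : ℝ))) ≤ (PE.size φ : ℝ))) := by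
  have H : ∀ n : ℕ, ∃ q : Set (At ℕ ℕ), 0 < n → _ := fun n => by
    by_cases hn : 0 < n
    · obtain ⟨q, hq⟩ := main_n n hn
      exact ⟨q, fun _ => hq⟩
    · exact ⟨∅, fun h => absurd h hn⟩
  choose qseq hq using H
  have hL : ∀ n : ℕ, 2 ≤ n → 2 ^ n ≤ n * (2 ^ n - 1) := by
    intro n hn
    have h1 : 2 ^ 1 ≤ 2 ^ n := Nat.pow_le_pow_right (by norm_num) (by omega)
    have h2 : 2 * (2 ^ n - 1) ≤ n * (2 ^ n - 1) := Nat.mul_le_mul_right _ hn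
    omega
  have hpw : ∀ n : ℕ, (2 : ℝ) ^ ((1 : ℝ) * (n : ℝ)) = ((2 ^ n : ℕ) : ℝ) := by
    intro n
    rw [one_mul, Real.rpow_natCast]; push_cast; rfl
  have hpw2 : ∀ m : ℕ, (2 : ℝ) ^ ((m : ℕ) : ℝ) = ((2 ^ m : ℕ) : ℝ) := by
    intro m
    rw [Real.rpow_natCast]; push_cast; rfl
  refine ⟨qseq, 1, one_pos, ⟨3 * (3 + 8 * Polynomial.X + 16 * Polynomial.X * (Polynomial.X + 3) +
      8 * Polynomial.X * (16 * Polynomial.X) + 16 * Polynomial.X) +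
      (24 * Polynomial.X + 1) * (3 + 8 * Polynomial.X + 16 * Polynomial.X * (Polynomial.X + 3) +
      8 * Polynomial.X * (16 * Polynomial.X) + 16 * Polynomial.X) ^ 2, fun n hn => ?_⟩,
    fun n hn => (hq n hn).2.1, fun n hn => (hq n hn).2.2.1, 2, fun n hn => ⟨?_, ?_⟩⟩
  · refine (hq n hn).1.trans (le_of_eq ?_)
    simp
  · intro k f hf
    have h1 := (hq n (by omega)).2.2.2.1 k f hf
    rw [hpw, hpw2, hpw2, ← Nat.cast_sum, Nat.cast_le]
    refine le_trans ?_ h1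
    exact Nat.pow_le_pow_right (by norm_num) (Nat.pow_le_pow_right (by norm_num) (hL n hn))
  · intro φ hf
    have h1 := (hq n (by omega)).2.2.2.2 φ hf
    rw [hpw, hpw2, Nat.cast_le]
    have h2 := (Nat.pow_le_pow_iff_right (by norm_num)).1 h1
    refine le_trans ?_ h2
    exact Nat.pow_le_pow_right (by norm_num) (hL n hn)

end DS
end
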